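/- arXiv:2509.06507 — 8 statements merged into one kernel-verified Lean document; each statement's English description precedes it below -/
import Mathlib

section
/- Inverse inequality for the mixed difference ∇_ω(φ ∇_θ u): let u, φ : ℤ × ℤ → ℝ be grid functions that are M-periodic in the first index, with u(i,0) = u(i,N) = 0 for all i, and let Φ > 0 satisfy |φ(i,j)| ≤ Φ for all i,j. Define ∇_ω(φ ∇_θ u)(i,j) = (φ(i,j+1)·∇_θ u(i,j+1) − φ(i,j−1)·∇_θ u(i,j−1))/(2h_ω). Then ‖∇_ω(φ ∇_θ u)‖ ≤ 2 Φ h_ω^{−1} ‖δ_θ u‖_θ, i.e. h_θ h_ω Σ_{i=0}^{M−1} Σ_{j=1}^{N−1} (∇_ω(φ ∇_θ u)(i,j))² ≤ 4 Φ² h_ω^{−2} · h_θ h_ω Σ_{i=0}^{M−1} Σ_{j=1}^{N−1} (δ_θ u(i,j))². -/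
theorem sum_Icc_add_one_add (f : ℤ → ℝ) {a b : ℤ} (hab : a ≤ b) :
    ∑ i ∈ Finset.Icc a b, f (i + 1) + f a = ∑ i ∈ Finset.Icc a b, f i + f (b + 1) := by
  induction b, hab using Int.leInduction with
  | base => simp [add_comm]
  | succ b hab ih =>
    have hIcc : Finset.Icc a (b + 1) = insert (b + 1) (Finset.Icc a b) := by
      ext x
      simp only [Finset.mem_Icc, Finset.mem_insert]
      omega
    have hmem : b + 1 ∉ Finset.Icc a b := by simp
    rw [hIcc, Finset.sum_insert hmem, Finset.sum_insert hmem]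
    linarith

theorem sum_Icc_sub_one_add (f : ℤ → ℝ) {a b : ℤ} (hab : a ≤ b) :
    ∑ i ∈ Finset.Icc a b, f (i - 1) + f b = ∑ i ∈ Finset.Icc a b, f i + f (a - 1) := by
  simpa using (sum_Icc_add_one_add (fun i => f (i - 1)) hab).symm

theorem sq_mul_central_difference_le {c C : ℝ} (hc : |c| ≤ C) (x y z h : ℝ) :
    (c * ((z - x) / (2 * h))) ^ 2 ≤ C ^ 2 * ((((z - y) / h) ^ 2 + ((y - x) / h) ^ 2) / 2) := by
  have hz : (z - x) / (2 * h) = ((z - y) / h + (y - x) / h) / 2 := by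
    rw [← add_div, sub_add_sub_cancel, div_div, mul_comm]
  rw [hz, mul_pow]
  have hcC : c ^ 2 ≤ C ^ 2 := sq_le_sq' (abs_le.mp hc).1 (abs_le.mp hc).2
  refine mul_le_mul hcC ?_ (sq_nonneg _) (sq_nonneg _)
  nlinarith [sq_nonneg ((z - y) / h - (y - x) / h)]

theorem sq_sub_div_two_mul_le (a b h : ℝ) :
    ((a - b) / (2 * h)) ^ 2 ≤ h⁻¹ ^ 2 / 2 * (a ^ 2 + b ^ 2) := by
  have hab : ((a - b) / (2 * h)) ^ 2 = h⁻¹ ^ 2 * ((a - b) ^ 2 / 4) := by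
    rw [div_pow, mul_pow, inv_pow, div_eq_mul_inv, mul_inv]
    ring
  rw [hab]
  nlinarith [mul_nonneg (sq_nonneg h⁻¹) (sq_nonneg (a + b))]

/-- The sum over one period of the weighted squared central difference is controlled by the
sum of the squared forward difference. -/
theorem sum_sq_mul_central_difference_le {M : ℤ} (hM : 1 ≤ M) (v c : ℤ → ℝ)
    (hv : ∀ i, v (i + M) = v i) {C : ℝ} (hc : ∀ i, |c i| ≤ C) (h : ℝ) :
    ∑ i ∈ Finset.Icc (0 : ℤ) (M - 1), (c i * ((v (i + 1) - v (i - 1)) / (2 * h))) ^ 2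
      ≤ C ^ 2 * ∑ i ∈ Finset.Icc (0 : ℤ) (M - 1), ((v (i + 1) - v i) / h) ^ 2 := by
  have hshift : ∑ i ∈ Finset.Icc (0 : ℤ) (M - 1), ((v i - v (i - 1)) / h) ^ 2
      = ∑ i ∈ Finset.Icc (0 : ℤ) (M - 1), ((v (i + 1) - v i) / h) ^ 2 := by
    have hs := sum_Icc_sub_one_add (fun i => ((v (i + 1) - v i) / h) ^ 2)
      (show (0 : ℤ) ≤ M - 1 by omega)
    have h0 : v M = v 0 := by simpa using hv 0
    have h1 : v (M - 1) = v (-1) := by rw [← hv (-1)]; congr 1; ring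
    simpa [h0, h1] using hs
  calc _ ≤ ∑ i ∈ Finset.Icc (0 : ℤ) (M - 1),
        C ^ 2 * ((((v (i + 1) - v i) / h) ^ 2 + ((v i - v (i - 1)) / h) ^ 2) / 2) :=
        Finset.sum_le_sum fun i _ => sq_mul_central_difference_le (hc i) _ _ _ _
    _ = _ := by
      rw [← Finset.mul_sum, ← Finset.sum_div, Finset.sum_add_distrib, hshift, add_self_div_two]

/-- Inverse inequality for the mixed difference `∇_ω(φ ∇_θ u)`:
`‖∇_ω(φ ∇_θ u)‖² ≤ 4 Φ² h_ω⁻² ‖δ_θ u‖_θ²`, where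
`∇_ω(φ ∇_θ u)(i,j) = (φ(i,j+1)·∇_θ u(i,j+1) - φ(i,j-1)·∇_θ u(i,j-1))/(2h_ω)` and
`∇_θ u (i,j) = (u(i+1,j) - u(i-1,j))/(2h_θ)`. -/
theorem inverse_inequality_mixed_omega_theta
    (M N : ℤ) (hM : 1 ≤ M) (hN : 2 ≤ N)
    (hθ hω : ℝ) (hhθ : 0 < hθ) (hhω : 0 < hω)
    (u φ : ℤ × ℤ → ℝ)
    (hu : ∀ i j : ℤ, u (i + M, j) = u (i, j))
    (hφ : ∀ i j : ℤ, φ (i + M, j) = φ (i, j))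
    (hu0 : ∀ i : ℤ, u (i, 0) = 0) (huN : ∀ i : ℤ, u (i, N) = 0)
    (Φ : ℝ) (hΦpos : 0 < Φ) (hΦ : ∀ i j : ℤ, |φ (i, j)| ≤ Φ) :
    hθ * hω * ∑ i ∈ Finset.Icc (0 : ℤ) (M - 1), ∑ j ∈ Finset.Icc (1 : ℤ) (N - 1),
      ((φ (i, j + 1) * ((u (i + 1, j + 1) - u (i - 1, j + 1)) / (2 * hθ))
        - φ (i, j - 1) * ((u (i + 1, j - 1) - u (i - 1, j - 1)) / (2 * hθ))) / (2 * hω)) ^ 2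
    ≤ 4 * Φ ^ 2 * hω⁻¹ ^ 2 *
      (hθ * hω * ∑ i ∈ Finset.Icc (0 : ℤ) (M - 1), ∑ j ∈ Finset.Icc (1 : ℤ) (N - 1),
        ((u (i + 1, j) - u (i, j)) / hθ) ^ 2) := by
  set D : ℤ → ℝ := fun j => ∑ i ∈ Finset.Icc (0 : ℤ) (M - 1),
    ((u (i + 1, j) - u (i, j)) / hθ) ^ 2 with hD
  have hDnonneg : ∀ j, 0 ≤ D j := fun j => Finset.sum_nonneg fun i _ => sq_nonneg _
  have hD0 : D 0 = 0 := by simp [hD, hu0]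
  have hDN : D N = 0 := by simp [hD, huN]
  have hrow : ∀ j k : ℤ, ∑ i ∈ Finset.Icc (0 : ℤ) (M - 1),
      ((φ (i, j) * ((u (i + 1, j) - u (i - 1, j)) / (2 * hθ))
        - φ (i, k) * ((u (i + 1, k) - u (i - 1, k)) / (2 * hθ))) / (2 * hω)) ^ 2
      ≤ hω⁻¹ ^ 2 / 2 * (Φ ^ 2 * D j + Φ ^ 2 * D k) := by
    intro j k
    refine (Finset.sum_le_sum fun i _ => sq_sub_div_two_mul_le _ _ _).trans ?_
    rw [← Finset.mul_sum, Finset.sum_add_distrib]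
    refine mul_le_mul_of_nonneg_left (add_le_add ?_ ?_) (by positivity)
    · exact sum_sq_mul_central_difference_le hM (fun i => u (i, j)) (fun i => φ (i, j))
        (fun i => hu i j) (fun i => hΦ i j) hθ
    · exact sum_sq_mul_central_difference_le hM (fun i => u (i, k)) (fun i => φ (i, k))
        (fun i => hu i k) (fun i => hΦ i k) hθ
  have hup := sum_Icc_add_one_add D (show (1 : ℤ) ≤ N - 1 by omega)
  have hdown := sum_Icc_sub_one_add D (show (1 : ℤ) ≤ N - 1 by omega)
  rw [sub_add_cancel, hDN] at hup
  rw [sub_self, hD0] at hdown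
  rw [Finset.sum_comm, Finset.sum_comm (s := Finset.Icc (0 : ℤ) (M - 1))
    (f := fun i j => ((u (i + 1, j) - u (i, j)) / hθ) ^ 2), mul_left_comm (4 * Φ ^ 2 * hω⁻¹ ^ 2)]
  refine mul_le_mul_of_nonneg_left ?_ (by positivity)
  refine (Finset.sum_le_sum fun j _ => hrow (j + 1) (j - 1)).trans ?_
  change _ ≤ 4 * Φ ^ 2 * hω⁻¹ ^ 2 * ∑ j ∈ Finset.Icc (1 : ℤ) (N - 1), D j
  rw [← Finset.mul_sum, Finset.sum_add_distrib, ← Finset.mul_sum, ← Finset.mul_sum, ← mul_add]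
  have hS : 0 ≤ ∑ j ∈ Finset.Icc (1 : ℤ) (N - 1), D j := Finset.sum_nonneg fun j _ => hDnonneg j
  have hle : ∑ j ∈ Finset.Icc (1 : ℤ) (N - 1), D (j + 1)
      + ∑ j ∈ Finset.Icc (1 : ℤ) (N - 1), D (j - 1)
      ≤ 8 * ∑ j ∈ Finset.Icc (1 : ℤ) (N - 1), D j := by
    linarith [hDnonneg 1, hDnonneg (N - 1)]
  calc _ = hω⁻¹ ^ 2 / 2 * Φ ^ 2 * (∑ j ∈ Finset.Icc (1 : ℤ) (N - 1), D (j + 1)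
      + ∑ j ∈ Finset.Icc (1 : ℤ) (N - 1), D (j - 1)) := by ring
    _ ≤ hω⁻¹ ^ 2 / 2 * Φ ^ 2 * (8 * ∑ j ∈ Finset.Icc (1 : ℤ) (N - 1), D j) :=
      mul_le_mul_of_nonneg_left hle (by positivity)
    _ = _ := by ring
end

section
/- Inverse inequality for the mixed difference ∇_θ(φ ∇_ω u): let u, φ : ℤ × ℤ → ℝ be grid functions that are M-periodic in the first index, with u(i,0) = u(i,N) = 0 for all i, and let Φ > 0 satisfy |φ(i,j)| ≤ Φ for all i,j. Define ∇_θ(φ ∇_ω u)(i,j) = (φ(i+1,j)·∇_ω u(i+1,j) − φ(i−1,j)·∇_ω u(i−1,j))/(2h_θ). Then ‖∇_θ(φ ∇_ω u)‖ ≤ 2 Φ h_θ^{−1} ‖δ_ω u‖_ω, i.e. h_θ h_ω Σ_{i=0}^{M−1} Σ_{j=1}^{N−1} (∇_θ(φ ∇_ω u)(i,j))² ≤ 4 Φ² h_θ^{−2} · h_θ h_ω Σ_{i=0}^{M−1} Σ_{j=0}^{N−1} (δ_ω u(i,j))². -/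
/-- The sum of a periodic function over one period is invariant under a unit shift. -/
theorem sum_Icc_shift_of_periodic {M : ℤ} (hM : 1 ≤ M) (f : ℤ → ℝ) (hf : ∀ i, f (i + M) = f i) :
    ∑ i ∈ Finset.Icc (0 : ℤ) (M - 1), f (i + 1) = ∑ i ∈ Finset.Icc (0 : ℤ) (M - 1), f i := by
  have hshift : ∑ i ∈ Finset.Icc (0 : ℤ) (M - 1), f (i + 1) = ∑ i ∈ Finset.Icc (1 : ℤ) M, f i :=
    Finset.sum_nbij' (fun i => i + 1) (fun i => i - 1)
      (by intro i hi; simp only [Finset.mem_Icc] at *; omega)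
      (by intro i hi; simp only [Finset.mem_Icc] at *; omega)
      (by intro i _; simp) (by intro i _; simp) (by intro i _; rfl)
  have hleft : Finset.Icc (0 : ℤ) (M - 1) = insert 0 (Finset.Icc 1 (M - 1)) := by
    ext i; simp only [Finset.mem_Icc, Finset.mem_insert]; omega
  have hright : Finset.Icc (1 : ℤ) M = insert M (Finset.Icc 1 (M - 1)) := by
    ext i; simp only [Finset.mem_Icc, Finset.mem_insert]; omega
  rw [hshift, hleft, hright, Finset.sum_insert (by simp), Finset.sum_insert (by simp)]
  have h := hf 0
  rw [zero_add] at h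
  rw [h]

theorem sum_Icc_add_pred_le (N : ℤ) (f : ℤ → ℝ) (hf : ∀ j, 0 ≤ f j) :
    ∑ j ∈ Finset.Icc (1 : ℤ) (N - 1), (f j + f (j - 1))
      ≤ 2 * ∑ j ∈ Finset.Icc (0 : ℤ) (N - 1), f j := by
  have hshift : ∑ j ∈ Finset.Icc (1 : ℤ) (N - 1), f (j - 1)
      = ∑ j ∈ Finset.Icc (0 : ℤ) (N - 2), f j :=
    Finset.sum_nbij' (fun j => j - 1) (fun j => j + 1)
      (by intro j hj; simp only [Finset.mem_Icc] at *; omega)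
      (by intro j hj; simp only [Finset.mem_Icc] at *; omega)
      (by intro j _; simp) (by intro j _; simp) (by intro j _; rfl)
  have h₁ : ∑ j ∈ Finset.Icc (1 : ℤ) (N - 1), f j ≤ ∑ j ∈ Finset.Icc (0 : ℤ) (N - 1), f j :=
    Finset.sum_le_sum_of_subset_of_nonneg
      (Finset.Icc_subset_Icc (by norm_num) le_rfl) (fun j _ _ => hf j)
  have h₂ : ∑ j ∈ Finset.Icc (0 : ℤ) (N - 2), f j ≤ ∑ j ∈ Finset.Icc (0 : ℤ) (N - 1), f j :=
    Finset.sum_le_sum_of_subset_of_nonneg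
      (Finset.Icc_subset_Icc le_rfl (by omega)) (fun j _ _ => hf j)
  rw [Finset.sum_add_distrib, hshift]
  linarith

/-- A product of a bounded factor with the mean of `x` and `y`, squared. -/
theorem sq_mul_mean_le {p Φ : ℝ} (hp : |p| ≤ Φ) (x y : ℝ) :
    (p * ((x + y) / 2)) ^ 2 ≤ Φ ^ 2 * ((x ^ 2 + y ^ 2) / 2) := by
  rw [mul_pow]
  have hpsq : p ^ 2 ≤ Φ ^ 2 := sq_le_sq' (abs_le.mp hp).1 (abs_le.mp hp).2
  exact mul_le_mul hpsq (by nlinarith [sq_nonneg (x - y)]) (sq_nonneg _) (sq_nonneg _)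


/-- Inverse inequality for the mixed difference `∇_θ(φ ∇_ω u)`:
`‖∇_θ(φ ∇_ω u)‖² ≤ 4 Φ² h_θ⁻² ‖δ_ω u‖_ω²`, where
`∇_θ(φ ∇_ω u)(i,j) = (φ(i+1,j)·∇_ω u(i+1,j) - φ(i-1,j)·∇_ω u(i-1,j))/(2h_θ)` and
`∇_ω u (i,j) = (u(i,j+1) - u(i,j-1))/(2h_ω)`. -/
theorem inverse_inequality_mixed_theta_omega
    (M N : ℤ) (hM : 1 ≤ M) (hN : 2 ≤ N)
    (hθ hω : ℝ) (hhθ : 0 < hθ) (hhω : 0 < hω)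
    (u φ : ℤ × ℤ → ℝ)
    (hu : ∀ i j : ℤ, u (i + M, j) = u (i, j))
    (hφ : ∀ i j : ℤ, φ (i + M, j) = φ (i, j))
    (hu0 : ∀ i : ℤ, u (i, 0) = 0) (huN : ∀ i : ℤ, u (i, N) = 0)
    (Φ : ℝ) (hΦpos : 0 < Φ) (hΦ : ∀ i j : ℤ, |φ (i, j)| ≤ Φ) :
    hθ * hω * ∑ i ∈ Finset.Icc (0 : ℤ) (M - 1), ∑ j ∈ Finset.Icc (1 : ℤ) (N - 1),
      ((φ (i + 1, j) * ((u (i + 1, j + 1) - u (i + 1, j - 1)) / (2 * hω))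
        - φ (i - 1, j) * ((u (i - 1, j + 1) - u (i - 1, j - 1)) / (2 * hω))) / (2 * hθ)) ^ 2
    ≤ 4 * Φ ^ 2 * hθ⁻¹ ^ 2 *
      (hθ * hω * ∑ i ∈ Finset.Icc (0 : ℤ) (M - 1), ∑ j ∈ Finset.Icc (0 : ℤ) (N - 1),
        ((u (i, j + 1) - u (i, j)) / hω) ^ 2) := by
  set d : ℤ → ℤ → ℝ := fun i j => ((u (i, j + 1) - u (i, j)) / hω) ^ 2 with hd
  set S : ℤ → ℝ := fun i => ∑ j ∈ Finset.Icc (0 : ℤ) (N - 1), d i j with hS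
  have hSper : ∀ i, S (i + M) = S i := by
    intro i
    simp only [hS, hd, hu]
  have hpoint : ∀ i j : ℤ,
      ((φ (i + 1, j) * ((u (i + 1, j + 1) - u (i + 1, j - 1)) / (2 * hω))
        - φ (i - 1, j) * ((u (i - 1, j + 1) - u (i - 1, j - 1)) / (2 * hω))) / (2 * hθ)) ^ 2
      ≤ Φ ^ 2 * hθ⁻¹ ^ 2 / 4 *
        ((d (i + 1) j + d (i + 1) (j - 1)) + (d (i - 1) j + d (i - 1) (j - 1))) := by
    intro i j
    have hmean : ∀ k : ℤ, (φ (k, j) * ((u (k, j + 1) - u (k, j - 1)) / (2 * hω))) ^ 2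
        ≤ Φ ^ 2 * ((d k j + d k (j - 1)) / 2) := by
      intro k
      have h := sq_mul_mean_le (hΦ k j) ((u (k, j + 1) - u (k, j)) / hω)
        ((u (k, j - 1 + 1) - u (k, j - 1)) / hω)
      have hsplit : (u (k, j + 1) - u (k, j - 1)) / (2 * hω)
          = ((u (k, j + 1) - u (k, j)) / hω + (u (k, j - 1 + 1) - u (k, j - 1)) / hω) / 2 := by
        rw [sub_add_cancel]
        field_simp
        ring
      rw [hsplit]
      exact h
    have h₁ := hmean (i + 1)
    have h₂ := hmean (i - 1)
    generalize φ (i + 1, j) * ((u (i + 1, j + 1) - u (i + 1, j - 1)) / (2 * hω)) = a at h₁ ⊢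
    generalize φ (i - 1, j) * ((u (i - 1, j + 1) - u (i - 1, j - 1)) / (2 * hω)) = b at h₂ ⊢
    calc ((a - b) / (2 * hθ)) ^ 2 = hθ⁻¹ ^ 2 / 4 * (a - b) ^ 2 := by field_simp; norm_num
      _ ≤ hθ⁻¹ ^ 2 / 4 * (Φ ^ 2 *
          ((d (i + 1) j + d (i + 1) (j - 1)) + (d (i - 1) j + d (i - 1) (j - 1)))) := by
        gcongr
        nlinarith [sq_nonneg (a + b)]
      _ = _ := by ring
  have hrow : ∀ i : ℤ, ∑ j ∈ Finset.Icc (1 : ℤ) (N - 1),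
      ((φ (i + 1, j) * ((u (i + 1, j + 1) - u (i + 1, j - 1)) / (2 * hω))
        - φ (i - 1, j) * ((u (i - 1, j + 1) - u (i - 1, j - 1)) / (2 * hω))) / (2 * hθ)) ^ 2
      ≤ Φ ^ 2 * hθ⁻¹ ^ 2 / 4 * (2 * S (i + 1) + 2 * S (i - 1)) := by
    intro i
    refine (Finset.sum_le_sum fun j _ => hpoint i j).trans ?_
    rw [← Finset.mul_sum, Finset.sum_add_distrib]
    gcongr
    · exact sum_Icc_add_pred_le N (d (i + 1)) fun j => sq_nonneg _
    · exact sum_Icc_add_pred_le N (d (i - 1)) fun j => sq_nonneg _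
  have hsucc := sum_Icc_shift_of_periodic hM S hSper
  have hpred := sum_Icc_shift_of_periodic hM (fun i => S (i - 1)) fun i => by
    rw [← hSper (i - 1), sub_add_eq_add_sub]
  simp only [add_sub_cancel_right] at hpred
  have hSnonneg : 0 ≤ ∑ i ∈ Finset.Icc (0 : ℤ) (M - 1), S i :=
    Finset.sum_nonneg fun i _ => Finset.sum_nonneg fun j _ => sq_nonneg _
  have htotal := Finset.sum_le_sum fun i (_ : i ∈ Finset.Icc (0 : ℤ) (M - 1)) => hrow i
  rw [← Finset.mul_sum, Finset.sum_add_distrib, ← Finset.mul_sum, ← Finset.mul_sum,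
    hsucc, ← hpred] at htotal
  rw [mul_left_comm (4 * Φ ^ 2 * hθ⁻¹ ^ 2)]
  refine mul_le_mul_of_nonneg_left (htotal.trans ?_) (by positivity)
  have hcoef : 0 ≤ Φ ^ 2 * hθ⁻¹ ^ 2 * ∑ i ∈ Finset.Icc (0 : ℤ) (M - 1), S i := by positivity
  linarith
end

section
/- Jacobian of the toroidal–poloidal coordinate transformation and its positivity (Theorem 4.1): let a > 0 and let R : ℝ² → ℝ be a positive continuously differentiable function of (θ, ω). Define Φ : ℝ³ → ℝ³ by Φ(r, θ, ω) = ((a − r R(θ,ω) cos θ) cos ω, (a − r R(θ,ω) cos θ) sin ω, r R(θ,ω) sin θ). Then for every (r, θ, ω), the Jacobian determinant det[∂Φ/∂r, ∂Φ/∂θ, ∂Φ/∂ω] (the determinant of the 3×3 matrix whose columns are the partial derivatives of Φ with respect to r, θ, ω) equals r R(θ,ω)² (a − r R(θ,ω) cos θ). Moreover, if R(θ,ω) cos θ < a for all (θ, ω) with cos θ > 0, then this determinant is strictly positive for all r ∈ (0, 1] and all (θ, ω). -/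
/-- The velocity of a curve given in toroidal coordinates `(ρ, θ, ω)`, where `ρ` is the distance
to the centerline of radius `a`. -/
theorem hasDerivAt_toroidal (a : ℝ) {ρ θ ω : ℝ → ℝ} {ρ' θ' ω' t : ℝ}
    (hρ : HasDerivAt ρ ρ' t) (hθ : HasDerivAt θ θ' t) (hω : HasDerivAt ω ω' t) :
    HasDerivAt (fun s => ![(a - ρ s * Real.cos (θ s)) * Real.cos (ω s),
        (a - ρ s * Real.cos (θ s)) * Real.sin (ω s), ρ s * Real.sin (θ s)])
      ![(ρ t * Real.sin (θ t) * θ' - ρ' * Real.cos (θ t)) * Real.cos (ω t)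
          - (a - ρ t * Real.cos (θ t)) * Real.sin (ω t) * ω',
        (ρ t * Real.sin (θ t) * θ' - ρ' * Real.cos (θ t)) * Real.sin (ω t)
          + (a - ρ t * Real.cos (θ t)) * Real.cos (ω t) * ω',
        ρ' * Real.sin (θ t) + ρ t * Real.cos (θ t) * θ'] t := by
  have hd := (hρ.mul hθ.cos).const_sub a
  refine hasDerivAt_pi.2 fun i => ?_
  fin_cases i
  · exact (hd.mul hω.cos).congr_deriv (by simp; ring)
  · exact (hd.mul hω.sin).congr_deriv (by simp; ring)
  · exact (hρ.mul hθ.sin).congr_deriv (by simp; ring)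

/-- Jacobian of the toroidal–poloidal coordinate transformation
`Φ(r,θ,ω) = ((a - rR cos θ) cos ω, (a - rR cos θ) sin ω, rR sin θ)` (with `R = R(θ,ω)`):
the Jacobian determinant equals `r R² (a - r R cos θ)`, and it is strictly positive for
`r ∈ (0,1]` provided `R(θ,ω) cos θ < a` whenever `cos θ > 0`. -/
theorem jacobian_toroidal_poloidal (a : ℝ) (ha : 0 < a)
    (R : ℝ → ℝ → ℝ)
    (hRpos : ∀ θ ω : ℝ, 0 < R θ ω)
    (hRC1 : ContDiff ℝ 1 (fun p : ℝ × ℝ => R p.1 p.2))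
    (Φ : ℝ → ℝ → ℝ → Fin 3 → ℝ)
    (hΦ : ∀ r θ ω : ℝ, Φ r θ ω =
      ![(a - r * R θ ω * Real.cos θ) * Real.cos ω,
        (a - r * R θ ω * Real.cos θ) * Real.sin ω,
        r * R θ ω * Real.sin θ]) :
    (∀ r θ ω : ℝ,
      Matrix.det (Matrix.of fun i j : Fin 3 =>
        ![deriv (fun r' => Φ r' θ ω) r,
          deriv (fun θ' => Φ r θ' ω) θ,
          deriv (fun ω' => Φ r θ ω') ω] j i)
      = r * R θ ω ^ 2 * (a - r * R θ ω * Real.cos θ))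
    ∧ ((∀ θ ω : ℝ, 0 < Real.cos θ → R θ ω * Real.cos θ < a) →
        ∀ r ∈ Set.Ioc (0 : ℝ) 1, ∀ θ ω : ℝ,
          0 < Matrix.det (Matrix.of fun i j : Fin 3 =>
            ![deriv (fun r' => Φ r' θ ω) r,
              deriv (fun θ' => Φ r θ' ω) θ,
              deriv (fun ω' => Φ r θ ω') ω] j i)) := by
  have det_eq : ∀ r θ ω : ℝ,
      Matrix.det (Matrix.of fun i j : Fin 3 =>
        ![deriv (fun r' => Φ r' θ ω) r,
          deriv (fun θ' => Φ r θ' ω) θ,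
          deriv (fun ω' => Φ r θ ω') ω] j i)
      = r * R θ ω ^ 2 * (a - r * R θ ω * Real.cos θ) := by
    intro r θ ω
    have hR : Differentiable ℝ fun p : ℝ × ℝ => R p.1 p.2 := hRC1.differentiable one_ne_zero
    have hRθ : HasDerivAt (fun θ' => R θ' ω) (deriv (fun θ' => R θ' ω) θ) θ := by
      have h : Differentiable ℝ fun θ' => R θ' ω :=
        hR.comp (differentiable_id.prodMk (differentiable_const ω))
      exact (h θ).hasDerivAt
    have hRω : HasDerivAt (fun ω' => R θ ω') (deriv (fun ω' => R θ ω') ω) ω := by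
      have h : Differentiable ℝ fun ω' => R θ ω' :=
        hR.comp ((differentiable_const θ).prodMk differentiable_id)
      exact (h ω).hasDerivAt
    simp only [hΦ]
    rw [(hasDerivAt_toroidal a ((hasDerivAt_id' r).mul_const (R θ ω))
        (hasDerivAt_const r θ) (hasDerivAt_const r ω)).deriv,
      (hasDerivAt_toroidal a (hRθ.const_mul r)
        (hasDerivAt_id' θ) (hasDerivAt_const θ ω)).deriv,
      (hasDerivAt_toroidal a (hRω.const_mul r)
        (hasDerivAt_const ω θ) (hasDerivAt_id' ω)).deriv]
    simp [Matrix.det_fin_three]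
    have hθ := Real.sin_sq_add_cos_sq θ
    have hω := Real.sin_sq_add_cos_sq ω
    grind
  refine ⟨det_eq, fun h r hr θ ω => ?_⟩
  rw [det_eq]
  have hR := hRpos θ ω
  have hr0 : 0 < r := hr.1
  have hlt : r * R θ ω * Real.cos θ < a := by
    rcases le_or_gt (Real.cos θ) 0 with hc | hc
    · exact (mul_nonpos_of_nonneg_of_nonpos (by positivity) hc).trans_lt ha
    · calc r * R θ ω * Real.cos θ = r * (R θ ω * Real.cos θ) := mul_assoc _ _ _
        _ ≤ R θ ω * Real.cos θ := mul_le_of_le_one_left (by positivity) hr.2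
        _ < a := h θ ω hc
  have := sub_pos.2 hlt
  positivity
end

section
/- Jacobian of the helical pipe coordinate transformation (Theorem 4.2): let a > 0, b ∈ ℝ, α = a/√(a²+b²), β = b/√(a²+b²), κ = a/(a²+b²), and let R : ℝ² → ℝ be a positive continuously differentiable function of (θ, ω). Define Φ : ℝ³ → ℝ³ by Φ(r, θ, ω) = (a cos ω + r R(θ,ω)(β sin θ sin ω − cos θ cos ω), a sin ω − r R(θ,ω)(β sin θ cos ω + cos θ sin ω), b ω + α r R(θ,ω) sin θ). Then for every (r, θ, ω), the Jacobian determinant det[∂Φ/∂r, ∂Φ/∂θ, ∂Φ/∂ω] equals r R(θ,ω)² √(a²+b²) (1 − κ r R(θ,ω) cos θ). -/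
/-- Jacobian of the helical pipe coordinate transformation: with
`α = a/√(a²+b²)`, `β = b/√(a²+b²)`, `κ = a/(a²+b²)` and cross-sectional shape `R(θ,ω)`,
the Jacobian determinant of
`Φ(r,θ,ω) = (a cos ω + rR(β sin θ sin ω - cos θ cos ω),
a sin ω - rR(β sin θ cos ω + cos θ sin ω), bω + α rR sin θ)`
equals `r R² √(a²+b²) (1 - κ r R cos θ)`. -/
theorem jacobian_helical_pipe (a b : ℝ) (ha : 0 < a)
    (α β κ : ℝ) (hα : α = a / Real.sqrt (a ^ 2 + b ^ 2))
    (hβ : β = b / Real.sqrt (a ^ 2 + b ^ 2))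
    (hκ : κ = a / (a ^ 2 + b ^ 2))
    (R : ℝ → ℝ → ℝ)
    (hRpos : ∀ θ ω : ℝ, 0 < R θ ω)
    (hRC1 : ContDiff ℝ 1 (fun p : ℝ × ℝ => R p.1 p.2))
    (Φ : ℝ → ℝ → ℝ → Fin 3 → ℝ)
    (hΦ : ∀ r θ ω : ℝ, Φ r θ ω =
      ![a * Real.cos ω + r * R θ ω *
          (β * Real.sin θ * Real.sin ω - Real.cos θ * Real.cos ω),
        a * Real.sin ω - r * R θ ω *
          (β * Real.sin θ * Real.cos ω + Real.cos θ * Real.sin ω),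
        b * ω + α * r * R θ ω * Real.sin θ]) :
    ∀ r θ ω : ℝ,
      Matrix.det (Matrix.of fun i j : Fin 3 =>
        ![deriv (fun r' => Φ r' θ ω) r,
          deriv (fun θ' => Φ r θ' ω) θ,
          deriv (fun ω' => Φ r θ ω') ω] j i)
      = r * R θ ω ^ 2 * Real.sqrt (a ^ 2 + b ^ 2)
          * (1 - κ * r * R θ ω * Real.cos θ) := by
  intro r θ ω
  have hdiff := hRC1.differentiable one_ne_zero
  have hP : HasDerivAt (fun t => R t ω) (deriv (fun t => R t ω) θ) θ :=
    ((hdiff (θ, ω)).comp (f := fun t : ℝ => (t, ω)) θ (by fun_prop)).hasDerivAt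
  have hQ : HasDerivAt (fun t => R θ t) (deriv (fun t => R θ t) ω) ω :=
    ((hdiff (θ, ω)).comp (f := fun t : ℝ => (θ, t)) ω (by fun_prop)).hasDerivAt
  generalize deriv (fun t => R t ω) θ = P at hP
  generalize deriv (fun t => R θ t) ω = Q at hQ
  have hr : HasDerivAt (fun r' => Φ r' θ ω)
      ![R θ ω * (β * Real.sin θ * Real.sin ω - Real.cos θ * Real.cos ω),
        -(R θ ω * (β * Real.sin θ * Real.cos ω + Real.cos θ * Real.sin ω)),
        α * R θ ω * Real.sin θ] r := by
    simp only [hΦ, hasDerivAt_pi, Fin.forall_fin_succ, Fin.forall_fin_zero, and_true]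
    refine ⟨?_, ?_, ?_⟩
    · exact ((((hasDerivAt_id r).mul_const (R θ ω)).mul_const
        (β * Real.sin θ * Real.sin ω - Real.cos θ * Real.cos ω)).const_add
        (a * Real.cos ω)).congr_deriv (by simp)
    · exact ((((hasDerivAt_id r).mul_const (R θ ω)).mul_const
        (β * Real.sin θ * Real.cos ω + Real.cos θ * Real.sin ω)).const_sub
        (a * Real.sin ω)).congr_deriv (by simp)
    · exact (((((hasDerivAt_id r).const_mul α).mul_const (R θ ω)).mul_const
        (Real.sin θ)).const_add (b * ω)).congr_deriv (by simp)
  have hθ : HasDerivAt (fun θ' => Φ r θ' ω)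
      ![r * P * (β * Real.sin θ * Real.sin ω - Real.cos θ * Real.cos ω)
          + r * R θ ω * (β * Real.cos θ * Real.sin ω + Real.sin θ * Real.cos ω),
        -(r * P * (β * Real.sin θ * Real.cos ω + Real.cos θ * Real.sin ω)
          + r * R θ ω * (β * Real.cos θ * Real.cos ω - Real.sin θ * Real.sin ω)),
        α * r * P * Real.sin θ + α * r * R θ ω * Real.cos θ] θ := by
    have hs := Real.hasDerivAt_sin θ
    have hc := Real.hasDerivAt_cos θ
    simp only [hΦ, hasDerivAt_pi, Fin.forall_fin_succ, Fin.forall_fin_zero, and_true]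
    refine ⟨?_, ?_, ?_⟩
    · exact (((hP.const_mul r).mul (((hs.const_mul β).mul_const (Real.sin ω)).sub
        (hc.mul_const (Real.cos ω)))).const_add (a * Real.cos ω)).congr_deriv (by simp)
    · exact (((hP.const_mul r).mul (((hs.const_mul β).mul_const (Real.cos ω)).add
        (hc.mul_const (Real.sin ω)))).const_sub (a * Real.sin ω)).congr_deriv
          (by simp [-mul_eq_mul_left_iff]; ring)
    · exact (((hP.const_mul (α * r)).mul hs).const_add (b * ω)).congr_deriv (by simp)
  have hω : HasDerivAt (fun ω' => Φ r θ ω')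
      ![-(a * Real.sin ω)
          + (r * Q * (β * Real.sin θ * Real.sin ω - Real.cos θ * Real.cos ω)
          + r * R θ ω * (β * Real.sin θ * Real.cos ω + Real.cos θ * Real.sin ω)),
        a * Real.cos ω
          - (r * Q * (β * Real.sin θ * Real.cos ω + Real.cos θ * Real.sin ω)
          + r * R θ ω * (Real.cos θ * Real.cos ω - β * Real.sin θ * Real.sin ω)),
        b + α * r * Q * Real.sin θ] ω := by
    have hs := Real.hasDerivAt_sin ω
    have hc := Real.hasDerivAt_cos ω
    simp only [hΦ, hasDerivAt_pi, Fin.forall_fin_succ, Fin.forall_fin_zero, and_true]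
    refine ⟨?_, ?_, ?_⟩
    · exact ((hc.const_mul a).add ((hQ.const_mul r).mul
        ((hs.const_mul (β * Real.sin θ)).sub (hc.const_mul (Real.cos θ))))).congr_deriv (by simp)
    · exact ((hs.const_mul a).sub ((hQ.const_mul r).mul
        ((hc.const_mul (β * Real.sin θ)).add (hs.const_mul (Real.cos θ))))).congr_deriv
          (by simp [-mul_eq_mul_left_iff]; ring)
    · exact (((hasDerivAt_id ω).const_mul b).add
        ((hQ.const_mul (α * r)).mul_const (Real.sin θ))).congr_deriv (by simp)
  rw [hr.deriv, hθ.deriv, hω.deriv, Matrix.det_fin_three]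
  have hpos : 0 < a ^ 2 + b ^ 2 := by positivity
  set s := Real.sqrt (a ^ 2 + b ^ 2) with hs
  have hs0 : s ≠ 0 := (Real.sqrt_pos.2 hpos).ne'
  have hs2 : s ^ 2 = a ^ 2 + b ^ 2 := Real.sq_sqrt hpos.le
  have hαs : a = α * s := by rw [hα]; field_simp
  have hβs : b = β * s := by rw [hβ]; field_simp
  have hκs : κ * s = α := by rw [hκ, hα, ← hs2]; field_simp
  have hαβ : α ^ 2 + β ^ 2 = 1 := by rw [hα, hβ]; field_simp; exact hs2.symm
  have hθ1 := Real.sin_sq_add_cos_sq θ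
  have hω1 := Real.sin_sq_add_cos_sq ω
  clear_value s
  simp
  clear hr hθ hω hΦ hP hQ hdiff hRC1 hRpos hα hβ hκ hs hs2 hpos ha
  generalize R θ ω = X at *
  generalize Real.sin θ = p at *
  generalize Real.cos θ = q at *
  generalize Real.sin ω = u at *
  generalize Real.cos ω = v at *
  subst hαs hβs
  grind
end

section
/- Covariant metric tensor of the helical pipe coordinates (proof of Theorem 2.1, specialized to the helix): let a > 0, b ∈ ℝ, α = a/√(a²+b²), β = b/√(a²+b²), κ = a/(a²+b²), and let R : ℝ² → ℝ be a positive continuously differentiable function of (θ, ω). Define Φ(r, θ, ω) = (a cos ω + r R(β sin θ sin ω − cos θ cos ω), a sin ω − r R(β sin θ cos ω + cos θ sin ω), b ω + α r R sin θ), where R = R(θ,ω). Write ∂_rΦ, ∂_θΦ, ∂_ωΦ for the partial derivative vectors and ⟨·,·⟩ for the Euclidean dot product, and set ρ = √(a²+b²)(1 − κ r R cos θ). Then at every (r, θ, ω): ⟨∂_rΦ, ∂_rΦ⟩ = R², ⟨∂_rΦ, ∂_θΦ⟩ = r R ∂_θR, ⟨∂_rΦ, ∂_ωΦ⟩ = r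 R ∂_ωR, ⟨∂_θΦ, ∂_θΦ⟩ = r² (R² + (∂_θR)²), ⟨∂_θΦ, ∂_ωΦ⟩ = r² β R² + r² (∂_θR)(∂_ωR), and ⟨∂_ωΦ, ∂_ωΦ⟩ = ρ² + r² β² R² + r² (∂_ωR)². -/
open Matrix

/-- Covariant metric tensor of the helical pipe coordinates: the pairwise Euclidean dot
products of the partial derivative vectors `∂_rΦ, ∂_θΦ, ∂_ωΦ` of
`Φ(r,θ,ω) = (a cos ω + rR(β sin θ sin ω - cos θ cos ω),
a sin ω - rR(β sin θ cos ω + cos θ sin ω), bω + α rR sin θ)`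
are the entries of the metric tensor `G = JᵀJ`, with
`ρ = √(a²+b²)(1 - κ r R cos θ)`. -/
theorem metric_tensor_helical_pipe (a b : ℝ) (ha : 0 < a)
    (α β κ : ℝ) (hα : α = a / Real.sqrt (a ^ 2 + b ^ 2))
    (hβ : β = b / Real.sqrt (a ^ 2 + b ^ 2))
    (hκ : κ = a / (a ^ 2 + b ^ 2))
    (R : ℝ → ℝ → ℝ)
    (hRpos : ∀ θ ω : ℝ, 0 < R θ ω)
    (hRC1 : ContDiff ℝ 1 (fun p : ℝ × ℝ => R p.1 p.2))
    (Φ : ℝ → ℝ → ℝ → Fin 3 → ℝ)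
    (hΦ : ∀ r θ ω : ℝ, Φ r θ ω =
      ![a * Real.cos ω + r * R θ ω *
          (β * Real.sin θ * Real.sin ω - Real.cos θ * Real.cos ω),
        a * Real.sin ω - r * R θ ω *
          (β * Real.sin θ * Real.cos ω + Real.cos θ * Real.sin ω),
        b * ω + α * r * R θ ω * Real.sin θ]) :
    ∀ r θ ω : ℝ,
      (deriv (fun r' => Φ r' θ ω) r ⬝ᵥ deriv (fun r' => Φ r' θ ω) r = R θ ω ^ 2)
      ∧ (deriv (fun r' => Φ r' θ ω) r ⬝ᵥ deriv (fun θ' => Φ r θ' ω) θ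
          = r * R θ ω * deriv (fun t => R t ω) θ)
      ∧ (deriv (fun r' => Φ r' θ ω) r ⬝ᵥ deriv (fun ω' => Φ r θ ω') ω
          = r * R θ ω * deriv (fun t => R θ t) ω)
      ∧ (deriv (fun θ' => Φ r θ' ω) θ ⬝ᵥ deriv (fun θ' => Φ r θ' ω) θ
          = r ^ 2 * (R θ ω ^ 2 + (deriv (fun t => R t ω) θ) ^ 2))
      ∧ (deriv (fun θ' => Φ r θ' ω) θ ⬝ᵥ deriv (fun ω' => Φ r θ ω') ω
          = r ^ 2 * β * R θ ω ^ 2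
            + r ^ 2 * deriv (fun t => R t ω) θ * deriv (fun t => R θ t) ω)
      ∧ (deriv (fun ω' => Φ r θ ω') ω ⬝ᵥ deriv (fun ω' => Φ r θ ω') ω
          = (Real.sqrt (a ^ 2 + b ^ 2) * (1 - κ * r * R θ ω * Real.cos θ)) ^ 2
            + r ^ 2 * β ^ 2 * R θ ω ^ 2
            + r ^ 2 * (deriv (fun t => R θ t) ω) ^ 2) := by
  intro r θ ω
  set q := Real.sqrt (a ^ 2 + b ^ 2) with hq
  have hpos : 0 < a ^ 2 + b ^ 2 := by positivity
  have hq0 : 0 < q := Real.sqrt_pos.2 hpos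
  have hqq : q ^ 2 = a ^ 2 + b ^ 2 := Real.sq_sqrt hpos.le
  have haq : a = α * q := by rw [hα]; field_simp
  have hbq : b = β * q := by rw [hβ]; field_simp
  have hκq : q * κ = α := by rw [hκ, hα, ← hqq]; field_simp
  have hαβ : α ^ 2 + β ^ 2 = 1 := by rw [hα, hβ]; field_simp; exact hqq.symm
  have hR : DifferentiableAt ℝ (fun p : ℝ × ℝ => R p.1 p.2) (θ, ω) :=
    hRC1.differentiable one_ne_zero _
  have hRθ : HasDerivAt (fun t => R t ω) (deriv (fun t => R t ω) θ) θ :=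
    (hR.comp (f := fun t => (t, ω)) θ (by fun_prop)).hasDerivAt
  have hRω : HasDerivAt (fun t => R θ t) (deriv (fun t => R θ t) ω) ω :=
    (hR.comp (f := fun t => (θ, t)) ω (by fun_prop)).hasDerivAt
  set Rθ := deriv (fun t => R t ω) θ
  set Rω := deriv (fun t => R θ t) ω
  have hr : deriv (fun r' => Φ r' θ ω) r =
      ![R θ ω * (β * Real.sin θ * Real.sin ω - Real.cos θ * Real.cos ω),
        -(R θ ω * (β * Real.sin θ * Real.cos ω + Real.cos θ * Real.sin ω)),
        α * R θ ω * Real.sin θ] := by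
    refine HasDerivAt.deriv (hasDerivAt_pi.2 fun i => ?_)
    have h := hasDerivAt_id' r
    simp only [hΦ]
    fin_cases i
    · exact (((h.mul_const _).mul_const _).const_add _).congr_deriv (by simp)
    · exact (((h.mul_const _).mul_const _).const_sub _).congr_deriv (by simp)
    · exact ((((h.const_mul _).mul_const _).mul_const _).const_add _).congr_deriv (by simp)
  have hθ : deriv (fun θ' => Φ r θ' ω) θ =
      ![r * Rθ * (β * Real.sin θ * Real.sin ω - Real.cos θ * Real.cos ω)
          + r * R θ ω * (β * Real.cos θ * Real.sin ω + Real.sin θ * Real.cos ω),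
        -(r * Rθ * (β * Real.sin θ * Real.cos ω + Real.cos θ * Real.sin ω)
          + r * R θ ω * (β * Real.cos θ * Real.cos ω - Real.sin θ * Real.sin ω)),
        α * r * Rθ * Real.sin θ + α * r * R θ ω * Real.cos θ] := by
    refine HasDerivAt.deriv (hasDerivAt_pi.2 fun i => ?_)
    have hs := Real.hasDerivAt_sin θ
    have hc := Real.hasDerivAt_cos θ
    simp only [hΦ]
    fin_cases i
    · exact (((hRθ.const_mul r).mul (((hs.const_mul β).mul_const _).sub
        (hc.mul_const _))).const_add _).congr_deriv (by simp)
    · exact (((hRθ.const_mul r).mul (((hs.const_mul β).mul_const _).add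
        (hc.mul_const _))).const_sub _).congr_deriv (by simp [sub_eq_add_neg])
    · exact (((hRθ.const_mul (α * r)).mul hs).const_add _).congr_deriv (by simp)
  have hω : deriv (fun ω' => Φ r θ ω') ω =
      ![-(a * Real.sin ω) + (r * Rω * (β * Real.sin θ * Real.sin ω - Real.cos θ * Real.cos ω)
          + r * R θ ω * (β * Real.sin θ * Real.cos ω + Real.cos θ * Real.sin ω)),
        a * Real.cos ω - (r * Rω * (β * Real.sin θ * Real.cos ω + Real.cos θ * Real.sin ω)
          + r * R θ ω * (Real.cos θ * Real.cos ω - β * Real.sin θ * Real.sin ω)),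
        b + α * r * Rω * Real.sin θ] := by
    refine HasDerivAt.deriv (hasDerivAt_pi.2 fun i => ?_)
    have hs := Real.hasDerivAt_sin ω
    have hc := Real.hasDerivAt_cos ω
    simp only [hΦ]
    fin_cases i
    · exact ((hc.const_mul a).add ((hRω.const_mul r).mul ((hs.const_mul _).sub
        (hc.const_mul _)))).congr_deriv (by simp)
    · exact ((hs.const_mul a).sub ((hRω.const_mul r).mul ((hc.const_mul _).add
        (hs.const_mul _)))).congr_deriv (by simp [sub_eq_neg_add])
    · exact (((hasDerivAt_id' ω).const_mul b).add
        ((hRω.const_mul (α * r)).mul_const _)).congr_deriv (by simp)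
  have hρ : q * (1 - κ * r * R θ ω * Real.cos θ) = q - α * r * R θ ω * Real.cos θ := by
    rw [← hκq]; ring
  rw [hr, hθ, hω, hρ]
  have h1 := Real.sin_sq_add_cos_sq θ
  have h2 := Real.sin_sq_add_cos_sq ω
  clear_value Rθ Rω q
  simp only [Matrix.vec3_dotProduct, Matrix.cons_val_zero, Matrix.cons_val_one, Matrix.cons_val]
  generalize Real.sin θ = s at *
  generalize Real.cos θ = c at *
  generalize Real.sin ω = S at *
  generalize Real.cos ω = C at *
  generalize R θ ω = ϱ at *
  rw [haq, hbq]
  clear * - hαβ h1 h2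
  refine ⟨?_, ?_, ?_, ?_, ?_, ?_⟩ <;> grind
end

section
/- Fourth-order accuracy of the one-dimensional compact operator (Lemma 3.3, θ-direction): let u, p : ℝ → ℝ with u six times continuously differentiable, p six times continuously differentiable and p(x) > 0 for all x. Set v = (p u')' (the derivative of x ↦ p(x) u'(x)), p̃ = (p')²/p − p''/2, and for h > 0 set p̂_h = p − (h²/12) p̃. For h > 0 define the discrete quantities at a point x: δ²v(x) = (v(x+h) − 2v(x) + v(x−h))/h², ∇((p'/p)v)(x) = ((p'/p · v)(x+h) − (p'/p · v)(x−h))/(2h), and δ(p̂_h δu)(x) = (p̂_h(x + h/2)(u(x+h) − u(x)) − p̂_h(x − h/2)(u(x) − u(x−h)))/h². Then for every compact set K ⊂ ℝ there exists C > 0 such that for all x ∈ K and all h ∈ (0, 1]: |v(x) + (h²/12) δ²v(x) − (h²/12) ∇((p'/p)v)(x) − δ(p̂_h δu)(x)| ≤ C h⁴. -/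
open Set Finset in
/-- Taylor's theorem at every point of a compact set, with a uniform two-sided remainder bound. -/
theorem exists_taylor_bound_of_isCompact {K : Set ℝ} (hK : IsCompact K) (n : ℕ) (f : ℝ → ℝ)
    (hf : ContDiff ℝ n f) :
    ∃ C : ℝ, ∀ x ∈ K, ∀ h ∈ Icc (-1 : ℝ) 1,
      |f (x + h) - ∑ k ∈ range n, iteratedDeriv k f x / k.factorial * h ^ k| ≤ C * |h| ^ n := by
  induction n generalizing f with
  | zero =>
    have hc : ContinuousOn (fun z : ℝ × ℝ => f (z.1 + z.2)) (K ×ˢ Icc (-1 : ℝ) 1) :=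
      (hf.continuous.comp (continuous_fst.add continuous_snd)).continuousOn
    obtain ⟨C, hC⟩ := (hK.prod isCompact_Icc).exists_bound_of_continuousOn hc
    refine ⟨C, fun x hx h hh => ?_⟩
    simpa using hC (x, h) ⟨hx, hh⟩
  | succ n ih =>
    have hf' : ContDiff ℝ n (deriv f) := (hf.of_le (by simp) : ContDiff ℝ (n + 1) f).deriv'
    obtain ⟨C, hC⟩ := ih (deriv f) hf'
    refine ⟨|C|, fun x hx h hh => ?_⟩
    have hd : ∀ t : ℝ, HasDerivAt
        (fun t => f (x + t) - ∑ k ∈ range (n + 1), iteratedDeriv k f x / k.factorial * t ^ k)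
        (deriv f (x + t)
          - ∑ k ∈ range n, iteratedDeriv k (deriv f) x / k.factorial * t ^ k) t := by
      intro t
      have h1 : HasDerivAt (fun t => f (x + t)) (deriv f (x + t)) t :=
        ((hf.differentiable (by simp)) (x + t)).hasDerivAt.comp_const_add x t
      refine h1.sub ?_
      have h2 : HasDerivAt
          (fun t => ∑ k ∈ range (n + 1), iteratedDeriv k f x / k.factorial * t ^ k)
          (∑ k ∈ range (n + 1), iteratedDeriv k f x / k.factorial * (k * t ^ (k - 1))) t :=
        HasDerivAt.fun_sum fun k _ => (hasDerivAt_pow k t).const_mul _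
      refine h2.congr_deriv ?_
      rw [sum_range_succ']
      simp only [Nat.cast_zero, zero_mul, mul_zero, add_zero, Nat.add_sub_cancel]
      refine sum_congr rfl fun k _ => ?_
      rw [← iteratedDeriv_succ', Nat.factorial_succ]
      push_cast
      field_simp
    have hb : ∀ t ∈ Icc (-|h|) |h|, ‖deriv f (x + t)
          - ∑ k ∈ range n, iteratedDeriv k (deriv f) x / k.factorial * t ^ k‖ ≤ |C| * |h| ^ n := by
      intro t ht
      have hth : |t| ≤ |h| := abs_le.2 ht
      have h1 : |h| ≤ 1 := abs_le.2 hh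
      refine (hC x hx t (abs_le.1 (hth.trans h1))).trans ?_
      gcongr
      exact le_abs_self C
    have := (convex_Icc (-|h|) |h|).norm_image_sub_le_of_norm_hasDerivWithin_le
      (fun t _ => (hd t).hasDerivWithinAt) hb (x := 0) (y := h)
      ⟨by simp, abs_nonneg h⟩ ⟨neg_abs_le h, le_abs_self h⟩
    simpa [sum_range_succ', pow_succ, mul_assoc] using this

open Set Finset in
/-- Truncated multiplication of two uniform Taylor expansions, the second without constant term. -/
theorem exists_truncated_mul_bound {K : Set ℝ} (hK : IsCompact K) (n : ℕ)
    (A B : ℝ → ℝ → ℝ) (a b : ℕ → ℝ → ℝ)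
    (ha : ∀ k < n, Continuous (a k)) (hb : ∀ k < n, Continuous (b k))
    (hA : ∃ C : ℝ, ∀ x ∈ K, ∀ h ∈ Icc (-1 : ℝ) 1,
      |A x h - ∑ k ∈ range n, a k x * h ^ k| ≤ C * |h| ^ n)
    (hB : ∃ C : ℝ, ∀ x ∈ K, ∀ h ∈ Icc (-1 : ℝ) 1,
      |B x h - h * ∑ k ∈ range n, b k x * h ^ k| ≤ C * |h| ^ (n + 1)) :
    ∃ C : ℝ, ∀ x ∈ K, ∀ h ∈ Icc (-1 : ℝ) 1,
      |A x h * B x h - h * ∑ i ∈ range n, ∑ j ∈ range n,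
        (if i + j < n then a i x * b j x * h ^ (i + j) else 0)| ≤ C * |h| ^ (n + 1) := by
  have bdd : ∀ F : ℝ × ℝ → ℝ, Continuous F →
      ∃ M, ∀ x ∈ K, ∀ h ∈ Icc (-1 : ℝ) 1, |F (x, h)| ≤ M := fun F hF => by
    obtain ⟨M, hM⟩ := (hK.prod isCompact_Icc).exists_bound_of_continuousOn hF.continuousOn
    exact ⟨M, fun x hx h hh => hM (x, h) ⟨hx, hh⟩⟩
  have poly : ∀ c : ℕ → ℝ → ℝ, (∀ k < n, Continuous (c k)) →
      Continuous fun z : ℝ × ℝ => ∑ k ∈ range n, c k z.1 * z.2 ^ k := fun c hc =>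
    continuous_finsetSum _ fun k hk =>
      ((hc k (mem_range.1 hk)).comp continuous_fst).mul (continuous_snd.pow k)
  obtain ⟨CA, hCA⟩ := hA
  obtain ⟨CB, hCB⟩ := hB
  obtain ⟨Ma, hMa⟩ := bdd _ (poly a ha)
  obtain ⟨Mb, hMb⟩ := bdd _ (poly b hb)
  obtain ⟨MR, hMR⟩ := bdd (fun z => ∑ i ∈ range n, ∑ j ∈ range n,
      (if i + j < n then 0 else a i z.1 * b j z.1 * z.2 ^ (i + j - n))) (by
    refine continuous_finsetSum _ fun i hi => continuous_finsetSum _ fun j hj => ?_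
    split_ifs
    · exact continuous_const
    · exact (((ha i (mem_range.1 hi)).comp continuous_fst).mul
        ((hb j (mem_range.1 hj)).comp continuous_fst)).mul (continuous_snd.pow _))
  refine ⟨|CA| * CB + CA * Mb + Ma * CB + MR, fun x hx h hh => ?_⟩
  have h1 : |h| ≤ 1 := abs_le.2 hh
  specialize hCA x hx h hh
  specialize hCB x hx h hh
  specialize hMa x hx h hh
  specialize hMb x hx h hh
  specialize hMR x hx h hh
  dsimp only at hMa hMb hMR
  have key : (∑ k ∈ range n, a k x * h ^ k) * (∑ k ∈ range n, b k x * h ^ k)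
      = (∑ i ∈ range n, ∑ j ∈ range n,
          (if i + j < n then a i x * b j x * h ^ (i + j) else 0))
        + h ^ n * ∑ i ∈ range n, ∑ j ∈ range n,
          (if i + j < n then 0 else a i x * b j x * h ^ (i + j - n)) := by
    rw [sum_mul_sum, mul_sum, ← sum_add_distrib]
    refine sum_congr rfl fun i _ => ?_
    rw [mul_sum, ← sum_add_distrib]
    refine sum_congr rfl fun j _ => ?_
    split_ifs with hij
    · ring
    · have : h ^ (i + j) = h ^ n * h ^ (i + j - n) := by
        rw [← pow_add, Nat.add_sub_cancel' (not_lt.1 hij)]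
      linear_combination (a i x * b j x) * this
  generalize (∑ k ∈ range n, a k x * h ^ k) = s at *
  generalize (∑ k ∈ range n, b k x * h ^ k) = t at *
  generalize (∑ i ∈ range n, ∑ j ∈ range n,
          (if i + j < n then 0 else a i x * b j x * h ^ (i + j - n))) = r at *
  have hsplit : A x h * B x h - h * ∑ i ∈ range n, ∑ j ∈ range n,
        (if i + j < n then a i x * b j x * h ^ (i + j) else 0)
      = (A x h - s) * (B x h - h * t) + (A x h - s) * (h * t) + s * (B x h - h * t)
        + h ^ (n + 1) * r := by
    linear_combination h * key
  have hCA0 : 0 ≤ CA * |h| ^ n := (abs_nonneg _).trans hCA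
  have hCB0 : 0 ≤ CB * |h| ^ (n + 1) := (abs_nonneg _).trans hCB
  have e1 : |(A x h - s) * (B x h - h * t)| ≤ |CA| * CB * |h| ^ (n + 1) := by
    have : CA * |h| ^ n ≤ |CA| := (mul_le_mul_of_nonneg_right (le_abs_self CA)
      (by positivity)).trans (mul_le_of_le_one_right (abs_nonneg _) (pow_le_one₀ (abs_nonneg h) h1))
    rw [abs_mul, mul_assoc]
    exact mul_le_mul (hCA.trans this) hCB (abs_nonneg _) (abs_nonneg _)
  have e2 : |(A x h - s) * (h * t)| ≤ CA * Mb * |h| ^ (n + 1) := by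
    rw [abs_mul, abs_mul]
    calc _ ≤ (CA * |h| ^ n) * (|h| * Mb) := by gcongr
      _ = _ := by ring
  have e3 : |s * (B x h - h * t)| ≤ Ma * CB * |h| ^ (n + 1) := by
    rw [abs_mul]
    calc _ ≤ Ma * (CB * |h| ^ (n + 1)) := by gcongr; exact (abs_nonneg _).trans hMa
      _ = _ := by ring
  have e4 : |h ^ (n + 1) * r| ≤ MR * |h| ^ (n + 1) := by
    rw [abs_mul, abs_pow, mul_comm]
    gcongr
  rw [hsplit]
  refine (abs_add_le _ _).trans ?_
  have := abs_add_three ((A x h - s) * (B x h - h * t)) ((A x h - s) * (h * t))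
    (s * (B x h - h * t))
  linarith

theorem ContDiff.hasDerivAt_iteratedDeriv {f : ℝ → ℝ} {n : WithTop ℕ∞} (hf : ContDiff ℝ n f)
    {k : ℕ} (hk : (k : WithTop ℕ∞) < n) (x : ℝ) :
    HasDerivAt (iteratedDeriv k f) (iteratedDeriv (k + 1) f x) x := by
  rw [iteratedDeriv_succ]
  exact (hf.differentiable_iteratedDeriv k hk x).hasDerivAt

/-- Fourth-order accuracy of the one-dimensional compact operator (θ-direction):
for `v = (p u')'`, `p̃ = (p')²/p - p''/2`, `p̂_h = p - (h²/12) p̃`, the compact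
combination `v + (h²/12) δ²v - (h²/12) ∇((p'/p)v)` approximates `δ(p̂_h δ u)`
to fourth order, uniformly on compact sets. -/
theorem compact_operator_fourth_order_1d
    (u p : ℝ → ℝ) (hu : ContDiff ℝ 6 u) (hp : ContDiff ℝ 6 p)
    (hppos : ∀ x : ℝ, 0 < p x) :
    ∀ K : Set ℝ, IsCompact K → ∃ C > 0, ∀ x ∈ K, ∀ h ∈ Set.Ioc (0 : ℝ) 1,
      |(deriv (fun y => p y * deriv u y) x
          + h ^ 2 / 12 *
            ((deriv (fun y => p y * deriv u y) (x + h)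
              - 2 * deriv (fun y => p y * deriv u y) x
              + deriv (fun y => p y * deriv u y) (x - h)) / h ^ 2)
          - h ^ 2 / 12 *
            ((deriv p (x + h) / p (x + h) * deriv (fun y => p y * deriv u y) (x + h)
              - deriv p (x - h) / p (x - h) * deriv (fun y => p y * deriv u y) (x - h))
              / (2 * h)))
        - ((p (x + h / 2) - h ^ 2 / 12 *
              ((deriv p (x + h / 2)) ^ 2 / p (x + h / 2)
                - iteratedDeriv 2 p (x + h / 2) / 2)) * (u (x + h) - u x)
            - (p (x - h / 2) - h ^ 2 / 12 *
              ((deriv p (x - h / 2)) ^ 2 / p (x - h / 2)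
                - iteratedDeriv 2 p (x - h / 2) / 2)) * (u x - u (x - h))) / h ^ 2|
      ≤ C * h ^ 4 := by
  intro K hK
  set v : ℝ → ℝ := fun y => deriv (fun y => p y * deriv u y) y with hv
  set w : ℝ → ℝ := fun y => deriv p y / p y * v y with hw
  set q : ℝ → ℝ := fun y => (deriv p y) ^ 2 / p y - iteratedDeriv 2 p y / 2 with hq
  have hp0 : ∀ y, p y ≠ 0 := fun y => (hppos y).ne'
  have hp1C : ContDiff ℝ 5 (deriv p) := (hp : ContDiff ℝ (5 + 1) p).deriv'
  have hp2C : ContDiff ℝ 4 (iteratedDeriv 2 p) := by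
    rw [iteratedDeriv_succ', iteratedDeriv_one]
    exact (hp1C : ContDiff ℝ (4 + 1) (deriv p)).deriv'
  have hu1C : ContDiff ℝ 5 (deriv u) := (hu : ContDiff ℝ (5 + 1) u).deriv'
  have hvC : ContDiff ℝ 4 v :=
    (((hp.of_le (by norm_num)).mul hu1C : ContDiff ℝ (4 + 1) fun y => p y * deriv u y)).deriv'
  have hwC : ContDiff ℝ 4 w :=
    ((hp1C.of_le (by norm_num)).div (hp.of_le (by norm_num)) hp0).mul hvC
  have hqC : ContDiff ℝ 4 q :=
    (((hp1C.of_le (by norm_num)).pow 2).div (hp.of_le (by norm_num)) hp0).sub (hp2C.div_const 2)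
  have dp : ∀ k < 6, ∀ y, HasDerivAt (iteratedDeriv k p) (iteratedDeriv (k + 1) p y) y :=
    fun k hk y => hp.hasDerivAt_iteratedDeriv (by exact_mod_cast hk) y
  have du : ∀ k < 6, ∀ y, HasDerivAt (iteratedDeriv k u) (iteratedDeriv (k + 1) u y) y :=
    fun k hk y => hu.hasDerivAt_iteratedDeriv (by exact_mod_cast hk) y
  have dp0 : ∀ y, HasDerivAt p (iteratedDeriv 1 p y) y := fun y => by
    simpa using dp 0 (by norm_num) y
  have v0 : v = fun y => iteratedDeriv 1 p y * iteratedDeriv 1 u y + p y * iteratedDeriv 2 u y := by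
    funext y
    have := ((dp0 y).fun_mul (du 1 (by norm_num) y)).deriv
    simpa [hv] using this
  have v1 : iteratedDeriv 1 v = fun y => iteratedDeriv 2 p y * iteratedDeriv 1 u y
      + 2 * (iteratedDeriv 1 p y * iteratedDeriv 2 u y) + p y * iteratedDeriv 3 u y := by
    funext y
    rw [iteratedDeriv_one, v0]
    refine ((((dp 1 (by norm_num) y).fun_mul (du 1 (by norm_num) y)).fun_add
      ((dp0 y).fun_mul (du 2 (by norm_num) y))).congr_deriv ?_).deriv
    ring
  have v2 : iteratedDeriv 2 v = fun y => iteratedDeriv 3 p y * iteratedDeriv 1 u y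
      + 3 * (iteratedDeriv 2 p y * iteratedDeriv 2 u y)
      + 3 * (iteratedDeriv 1 p y * iteratedDeriv 3 u y) + p y * iteratedDeriv 4 u y := by
    funext y
    rw [iteratedDeriv_succ, v1]
    refine (((((dp 2 (by norm_num) y).fun_mul (du 1 (by norm_num) y)).fun_add
      (((dp 1 (by norm_num) y).fun_mul (du 2 (by norm_num) y)).const_mul 2)).fun_add
      ((dp0 y).fun_mul (du 3 (by norm_num) y))).congr_deriv ?_).deriv
    ring
  have w1 : ∀ y, iteratedDeriv 1 w y =
      (iteratedDeriv 2 p y * p y - iteratedDeriv 1 p y * iteratedDeriv 1 p y) / p y ^ 2 * v y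
        + iteratedDeriv 1 p y / p y * iteratedDeriv 1 v y := by
    intro y
    have hv1 : HasDerivAt v (iteratedDeriv 1 v y) y := by
      simpa using hvC.hasDerivAt_iteratedDeriv (k := 0) (by norm_num) y
    have := (((dp 1 (by norm_num) y).fun_div (dp0 y) (hp0 y)).fun_mul hv1).deriv
    simpa [hw] using this
  have q1 : ∀ y, iteratedDeriv 1 q y =
      (2 * iteratedDeriv 1 p y * iteratedDeriv 2 p y * p y - iteratedDeriv 1 p y ^ 3) / p y ^ 2
        - iteratedDeriv 3 p y / 2 := by
    intro y
    have := (((((dp 1 (by norm_num) y).fun_pow 2).fun_div (dp0 y) (hp0 y)).fun_sub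
      ((dp 2 (by norm_num) y).div_const 2))).deriv
    rw [iteratedDeriv_one, hq, ← iteratedDeriv_one (f := p), this]
    norm_num
    ring
  set a : ℕ → ℝ → ℝ := fun k y => iteratedDeriv k p y / k.factorial / 2 ^ k -
    if 2 ≤ k then iteratedDeriv (k - 2) q y / (k - 2).factorial / 2 ^ (k - 2) / 12 else 0 with ha
  set b : ℕ → ℝ → ℝ := fun k y => iteratedDeriv (k + 1) u y / (k + 1).factorial with hb
  have hac : ∀ k < 5, Continuous (a k) := by
    intro k hk
    have h1 : Continuous (iteratedDeriv k p) :=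
      hp.continuous_iteratedDeriv k (by exact_mod_cast (by omega : k ≤ 6))
    have h2 : Continuous (iteratedDeriv (k - 2) q) :=
      hqC.continuous_iteratedDeriv (k - 2) (by exact_mod_cast (by omega : k - 2 ≤ 4))
    simp only [ha]
    split_ifs <;> fun_prop
  have hbc : ∀ k < 5, Continuous (b k) := fun k hk =>
    (hu.continuous_iteratedDeriv (k + 1) (by exact_mod_cast (by omega : k + 1 ≤ 6))).div_const _
  obtain ⟨Cu, hCu⟩ := exists_taylor_bound_of_isCompact hK 6 u hu
  obtain ⟨Cp, hCp⟩ := exists_taylor_bound_of_isCompact hK 5 p (hp.of_le (by norm_num))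
  obtain ⟨Cq, hCq⟩ := exists_taylor_bound_of_isCompact hK 3 q (hqC.of_le (by norm_num))
  obtain ⟨Cv, hCv⟩ := exists_taylor_bound_of_isCompact hK 4 v hvC
  obtain ⟨Cw, hCw⟩ := exists_taylor_bound_of_isCompact hK 3 w (hwC.of_le (by norm_num))
  obtain ⟨D, hD⟩ := exists_truncated_mul_bound hK 5
    (fun x h => p (x + h / 2) - h ^ 2 / 12 * q (x + h / 2)) (fun x h => u (x + h) - u x) a b hac hbc
    (by
      refine ⟨Cp / 32 + Cq / 96, fun x hx h hh => ?_⟩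
      have hh2 : h / 2 ∈ Set.Icc (-1 : ℝ) 1 := ⟨by linarith [hh.1], by linarith [hh.2]⟩
      have ep := hCp x hx _ hh2
      have eq := hCq x hx _ hh2
      have e := abs_sub (p (x + h / 2) - ∑ k ∈ Finset.range 5,
          iteratedDeriv k p x / k.factorial * (h / 2) ^ k)
        (h ^ 2 / 12 * (q (x + h / 2) - ∑ k ∈ Finset.range 3,
          iteratedDeriv k q x / k.factorial * (h / 2) ^ k))
      rw [abs_mul (h ^ 2 / 12), abs_div (h ^ 2), abs_pow h, abs_of_pos (by norm_num : (0 : ℝ) < 12)]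
        at e
      have eq' := mul_le_mul_of_nonneg_left eq (by positivity : 0 ≤ |h| ^ 2 / 12)
      rw [abs_div h, abs_of_pos (by norm_num : (0 : ℝ) < 2)] at ep eq'
      refine le_trans (le_of_eq ?_) ((e.trans (add_le_add ep eq')).trans (le_of_eq ?_))
      · congr 1
        simp [Finset.sum_range_succ, ha, Nat.factorial]
        ring
      · ring)
    (by
      refine ⟨Cu, fun x hx h hh => ?_⟩
      convert hCu x hx h hh using 2
      simp [Finset.sum_range_succ, hb, Nat.factorial]
      ring)
  refine ⟨|Cv / 6 + Cw / 12 + 2 * D| + 1, by positivity, fun x hx h hh => ?_⟩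
  have hpos : 0 < h := hh.1
  have hp' : h ∈ Set.Icc (-1 : ℝ) 1 := ⟨by linarith, hh.2⟩
  have hm' : -h ∈ Set.Icc (-1 : ℝ) 1 := ⟨by linarith [hh.2], by linarith⟩
  have rvp := hCv x hx h hp'
  have rvm := hCv x hx (-h) hm'
  have rwp := hCw x hx h hp'
  have rwm := hCw x hx (-h) hm'
  have rDp := hD x hx h hp'
  have rDm := hD x hx (-h) hm'
  have hsub : x + -h / 2 = x - h / 2 := by ring
  simp only [abs_neg, abs_of_pos hpos, ← sub_eq_add_neg, hsub] at rvp rvm rwp rwm rDp rDm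
  have hv2 := congrFun v2 x
  have hv1 := congrFun v1 x
  have hv0 := congrFun v0 x
  have hw1 := w1 x
  have hq1 := q1 x
  have hq0 : q x = iteratedDeriv 1 p x ^ 2 / p x - iteratedDeriv 2 p x / 2 := by
    simp [hq]
  have hpx := hp0 x
  simp only [Finset.sum_range_succ, Finset.sum_range_zero, ha, hb, Nat.factorial]
    at rvp rvm rwp rwm rDp rDm
  norm_num at rvp rvm rwp rwm rDp rDm
  simp only [iteratedDeriv_one] at hv2 hv1 hv0 hw1 hq1 hq0
  have fourth_order : iteratedDeriv 2 v x / 12 - deriv w x / 12 =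
      2 * (p x * (iteratedDeriv 4 u x / 24) + deriv p x / 2 * (iteratedDeriv 3 u x / 6)
        + (iteratedDeriv 2 p x / 2 / 4 - q x / 12) * (iteratedDeriv 2 u x / 2)
        + (iteratedDeriv 3 p x / 6 / 8 - deriv q x / 2 / 12) * deriv u x) := by
    rw [hv2, hw1, hq1, hq0, hv1, hv0]
    field_simp
    ring
  have second_order : v x = 2 * (p x * (iteratedDeriv 2 u x / 2) + deriv p x / 2 * deriv u x) := by
    rw [hv0]
    ring
  change |(v x + h ^ 2 / 12 * ((v (x + h) - 2 * v x + v (x - h)) / h ^ 2)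
      - h ^ 2 / 12 * ((w (x + h) - w (x - h)) / (2 * h)))
      - ((p (x + h / 2) - h ^ 2 / 12 * q (x + h / 2)) * (u (x + h) - u x)
        - (p (x - h / 2) - h ^ 2 / 12 * q (x - h / 2)) * (u x - u (x - h))) / h ^ 2| ≤ _
  have hC := le_abs_self (Cv / 6 + Cw / 12 + 2 * D)
  generalize |Cv / 6 + Cw / 12 + 2 * D| = C at hC
  have scaled : ∀ c r B : ℝ, 0 ≤ c → |r| ≤ B → |c * r| ≤ c * B := fun c r B hc hr => by
    rw [abs_mul, abs_of_nonneg hc]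
    exact mul_le_mul_of_nonneg_left hr hc
  have c2 : 0 ≤ h ^ 2 / 12 := by positivity
  have c3 : 0 ≤ h ^ 3 / 24 := by positivity
  have svp := abs_le.1 (scaled _ _ _ c2 rvp)
  have svm := abs_le.1 (scaled _ _ _ c2 rvm)
  have swp := abs_le.1 (scaled _ _ _ c3 rwp)
  have swm := abs_le.1 (scaled _ _ _ c3 rwm)
  have sDp := abs_le.1 rDp
  have sDm := abs_le.1 rDm
  have h6 : (0 : ℝ) < h ^ 6 := by positivity
  have hC6 : (Cv / 6 + Cw / 12 + 2 * D) * h ^ 6 ≤ C * h ^ 6 :=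
    mul_le_mul_of_nonneg_right hC h6.le
  have clear_denom : ∀ P Q R : ℝ, v x + h ^ 2 / 12 * (P / h ^ 2) - h ^ 2 / 12 * (Q / (2 * h))
      - R / h ^ 2 = (h ^ 2 * v x + h ^ 2 / 12 * P - h ^ 3 / 24 * Q - R) / h ^ 2 := by
    intro P Q R
    field_simp
    ring
  have e2 := congrArg (fun z => h ^ 2 * z) second_order
  have e4 := congrArg (fun z => h ^ 4 * z) fourth_order
  rw [clear_denom, abs_div, abs_of_pos (by positivity : 0 < h ^ 2), div_le_iff₀ (by positivity),
    abs_le]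
  constructor
  · linarith [svp.1, svm.1, swp.2, swm.1, sDp.2, sDm.2]
  · linarith [svp.2, svm.2, swp.1, swm.2, sDp.1, sDm.1]
end

section
/- Exact commutator identity for the compact operators 𝒜_θ and 𝓑_ω (content of Lemma 3.4): let f, ψ, χ : ℤ × ℤ → ℝ be arbitrary grid functions and h_θ, h_ω > 0. Define 𝒜g(i,j) = g(i,j) + (h_θ²/12) δ_θ² g(i,j) − (h_θ²/12) ∇_θ(ψ·g)(i,j) and 𝓑g(i,j) = g(i,j) + (h_ω²/12) δ_ω² g(i,j) − (h_ω²/12) ∇_ω(χ·g)(i,j), where ψ·g and χ·g denote pointwise products. Then for all (i,j): 𝒜(𝓑f)(i,j) − 𝓑(𝒜f)(i,j) = −(h_θ² h_ω²/144) [ δ_θ²(∇_ω(χ·f))(i,j) − ∇_ω(χ·(δ_θ² f))(i,j) + ∇_θ(ψ·(δ_ω² f))(i,j) − δ_ω²(∇_θ(ψ·f))(i,j) + ∇_ω(χ·∇_θ(ψ·f))(i,j) − ∇_θ(ψ·∇_ω(χ·f))(i,j) ]. -/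
/-- Second θ-difference: `δ_θ² g (i,j) = (g(i+1,j) - 2g(i,j) + g(i-1,j))/h_θ²`. -/
noncomputable def dThetaSq (hθ : ℝ) (g : ℤ × ℤ → ℝ) : ℤ × ℤ → ℝ :=
  fun x => (g (x.1 + 1, x.2) - 2 * g x + g (x.1 - 1, x.2)) / hθ ^ 2

/-- Second ω-difference: `δ_ω² g (i,j) = (g(i,j+1) - 2g(i,j) + g(i,j-1))/h_ω²`. -/
noncomputable def dOmegaSq (hω : ℝ) (g : ℤ × ℤ → ℝ) : ℤ × ℤ → ℝ :=
  fun x => (g (x.1, x.2 + 1) - 2 * g x + g (x.1, x.2 - 1)) / hω ^ 2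

/-- Central θ-difference: `∇_θ g (i,j) = (g(i+1,j) - g(i-1,j))/(2h_θ)`. -/
noncomputable def nablaTheta (hθ : ℝ) (g : ℤ × ℤ → ℝ) : ℤ × ℤ → ℝ :=
  fun x => (g (x.1 + 1, x.2) - g (x.1 - 1, x.2)) / (2 * hθ)

/-- Central ω-difference: `∇_ω g (i,j) = (g(i,j+1) - g(i,j-1))/(2h_ω)`. -/
noncomputable def nablaOmega (hω : ℝ) (g : ℤ × ℤ → ℝ) : ℤ × ℤ → ℝ :=
  fun x => (g (x.1, x.2 + 1) - g (x.1, x.2 - 1)) / (2 * hω)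

/-- The compact operator `𝒜 g = g + (h_θ²/12) δ_θ² g - (h_θ²/12) ∇_θ(ψ·g)`. -/
noncomputable def compactA (hθ : ℝ) (ψ : ℤ × ℤ → ℝ) (g : ℤ × ℤ → ℝ) : ℤ × ℤ → ℝ :=
  fun x => g x + hθ ^ 2 / 12 * dThetaSq hθ g x
    - hθ ^ 2 / 12 * nablaTheta hθ (fun y => ψ y * g y) x

/-- The compact operator `𝓑 g = g + (h_ω²/12) δ_ω² g - (h_ω²/12) ∇_ω(χ·g)`. -/
noncomputable def compactB (hω : ℝ) (χ : ℤ × ℤ → ℝ) (g : ℤ × ℤ → ℝ) : ℤ × ℤ → ℝ :=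
  fun x => g x + hω ^ 2 / 12 * dOmegaSq hω g x
    - hω ^ 2 / 12 * nablaOmega hω (fun y => χ y * g y) x

/-- Exact commutator identity for the compact operators `𝒜_θ` and `𝓑_ω`
(content of Lemma 3.4): the commutator `𝒜𝓑f - 𝓑𝒜f` equals
`-(h_θ²h_ω²/144)` times an explicit combination of mixed differences. -/
theorem compact_operator_commutator
    (f ψ χ : ℤ × ℤ → ℝ) (hθ hω : ℝ) (hhθ : 0 < hθ) (hhω : 0 < hω) :
    ∀ i j : ℤ,
      compactA hθ ψ (compactB hω χ f) (i, j) - compactB hω χ (compactA hθ ψ f) (i, j)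
      = -(hθ ^ 2 * hω ^ 2 / 144) *
        (dThetaSq hθ (nablaOmega hω (fun y => χ y * f y)) (i, j)
          - nablaOmega hω (fun y => χ y * dThetaSq hθ f y) (i, j)
          + nablaTheta hθ (fun y => ψ y * dOmegaSq hω f y) (i, j)
          - dOmegaSq hω (nablaTheta hθ (fun y => ψ y * f y)) (i, j)
          + nablaOmega hω (fun y => χ y * nablaTheta hθ (fun z => ψ z * f z) y) (i, j)
          - nablaTheta hθ (fun y => ψ y * nablaOmega hω (fun z => χ z * f z) y) (i, j)) := by
  intro i j
  simp only [compactA, compactB, dThetaSq, dOmegaSq, nablaTheta, nablaOmega]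
  ring
end

section
/- Fourth-order accuracy of the compact operator 𝒞_{θω} for the mixed derivative (Lemma 3.5, first identity): let u, q : ℝ² → ℝ be six times continuously differentiable functions of (θ, ω) with q > 0 everywhere. Set ṽ = ∂_ω(q ∂_θ u), q̃₁ = (∂_θ q)²/q − (1/2) ∂_θ² q, q̄ = ∂_ω(∂_θ q / q), and for h_θ > 0 set q̂₁ = q − (h_θ²/3) q̃₁. For h_θ, h_ω > 0 define at a point (θ,ω): δ_θ² g = (g(θ+h_θ,ω) − 2g(θ,ω) + g(θ−h_θ,ω))/h_θ², δ_ω² g = (g(θ,ω+h_ω) − 2g(θ,ω) + g(θ,ω−h_ω))/h_ω², ∇_θ g = (g(θ+h_θ,ω) − g(θ−h_θ,ω))/(2h_θ), the compact operator 𝒞ṽ = ṽ + (h_θ²/6) δ_θ² ṽ + (h_ω²/6) δ_ω² ṽ − (h_θ²/3) (∂_θ q/q)(θ,ω) ∇_θ ṽ, and the discrete quantities ∇_ω(q̂₁ ∇_θ u)(θ,ω) = (q̂₁(θ,ω+h_ω) ∇_θ u(θ,ω+h_ω) − q̂₁(θ,ω−h_ω) ∇_θ u(θ,ω−h_ω))/(2h_ω)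 and δ_θ(q δ_θ u)(θ,ω) = (q(θ+h_θ/2,ω)(u(θ+h_θ,ω) − u(θ,ω)) − q(θ−h_θ/2,ω)(u(θ,ω) − u(θ−h_θ,ω)))/h_θ². Then for every compact set K ⊂ ℝ² there exists C > 0 such that for all (θ,ω) ∈ K and all h_θ, h_ω ∈ (0,1]: |𝒞ṽ(θ,ω) − ∇_ω(q̂₁ ∇_θ u)(θ,ω) − (h_θ²/3) q̄(θ,ω) δ_θ(q δ_θ u)(θ,ω)| ≤ C (max(h_θ, h_ω))⁴. -/
/-- Partial derivative in the first variable. -/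
noncomputable def pdTheta (f : ℝ → ℝ → ℝ) (θ ω : ℝ) : ℝ := deriv (fun t => f t ω) θ

/-- Partial derivative in the second variable. -/
noncomputable def pdOmega (f : ℝ → ℝ → ℝ) (θ ω : ℝ) : ℝ := deriv (fun t => f θ t) ω

/-- The mixed derivative `ṽ = ∂_ω(q ∂_θ u)`. -/
noncomputable def vTilde (u q : ℝ → ℝ → ℝ) (θ ω : ℝ) : ℝ :=
  pdOmega (fun θ' ω' => q θ' ω' * pdTheta u θ' ω') θ ω

/-- `q̃₁ = (∂_θ q)²/q - (1/2)∂_θ² q`. -/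
noncomputable def qTilde1 (q : ℝ → ℝ → ℝ) (θ ω : ℝ) : ℝ :=
  (pdTheta q θ ω) ^ 2 / q θ ω - (1 / 2) * iteratedDeriv 2 (fun t => q t ω) θ

/-- `q̄ = ∂_ω(∂_θ q / q)`. -/
noncomputable def qBar (q : ℝ → ℝ → ℝ) (θ ω : ℝ) : ℝ :=
  pdOmega (fun θ' ω' => pdTheta q θ' ω' / q θ' ω') θ ω

/-- `q̂₁ = q - (h_θ²/3) q̃₁`. -/
noncomputable def qHat1 (q : ℝ → ℝ → ℝ) (hθ θ ω : ℝ) : ℝ :=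
  q θ ω - hθ ^ 2 / 3 * qTilde1 q θ ω

/-- Second θ-difference at a point: `δ_θ² g = (g(θ+h_θ,ω) - 2g(θ,ω) + g(θ-h_θ,ω))/h_θ²`. -/
noncomputable def dscThetaSq (hθ : ℝ) (g : ℝ → ℝ → ℝ) (θ ω : ℝ) : ℝ :=
  (g (θ + hθ) ω - 2 * g θ ω + g (θ - hθ) ω) / hθ ^ 2

/-- Second ω-difference at a point: `δ_ω² g = (g(θ,ω+h_ω) - 2g(θ,ω) + g(θ,ω-h_ω))/h_ω²`. -/
noncomputable def dscOmegaSq (hω : ℝ) (g : ℝ → ℝ → ℝ) (θ ω : ℝ) : ℝ :=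
  (g θ (ω + hω) - 2 * g θ ω + g θ (ω - hω)) / hω ^ 2

/-- Central θ-difference at a point: `∇_θ g = (g(θ+h_θ,ω) - g(θ-h_θ,ω))/(2h_θ)`. -/
noncomputable def dscNablaTheta (hθ : ℝ) (g : ℝ → ℝ → ℝ) (θ ω : ℝ) : ℝ :=
  (g (θ + hθ) ω - g (θ - hθ) ω) / (2 * hθ)

/-- The compact operator `𝒞ṽ = ṽ + (h_θ²/6)δ_θ²ṽ + (h_ω²/6)δ_ω²ṽ - (h_θ²/3)(∂_θq/q)∇_θṽ`. -/
noncomputable def compactC (u q : ℝ → ℝ → ℝ) (hθ hω θ ω : ℝ) : ℝ :=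
  vTilde u q θ ω + hθ ^ 2 / 6 * dscThetaSq hθ (vTilde u q) θ ω
    + hω ^ 2 / 6 * dscOmegaSq hω (vTilde u q) θ ω
    - hθ ^ 2 / 3 * (pdTheta q θ ω / q θ ω) * dscNablaTheta hθ (vTilde u q) θ ω

/-- Discrete mixed derivative
`∇_ω(q̂₁ ∇_θ u)(θ,ω) = (q̂₁(θ,ω+h_ω)∇_θu(θ,ω+h_ω) - q̂₁(θ,ω-h_ω)∇_θu(θ,ω-h_ω))/(2h_ω)`. -/
noncomputable def dscMixed (u q : ℝ → ℝ → ℝ) (hθ hω θ ω : ℝ) : ℝ :=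
  (qHat1 q hθ θ (ω + hω) * ((u (θ + hθ) (ω + hω) - u (θ - hθ) (ω + hω)) / (2 * hθ))
    - qHat1 q hθ θ (ω - hω) * ((u (θ + hθ) (ω - hω) - u (θ - hθ) (ω - hω)) / (2 * hθ)))
    / (2 * hω)

/-- Discrete second-order term `δ_θ(q δ_θ u)(θ,ω)` with half-point coefficients. -/
noncomputable def dscSecond (u q : ℝ → ℝ → ℝ) (hθ θ ω : ℝ) : ℝ :=
  (q (θ + hθ / 2) ω * (u (θ + hθ) ω - u θ ω)
    - q (θ - hθ / 2) ω * (u θ ω - u (θ - hθ) ω)) / hθ ^ 2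

open Set Filter Asymptotics

/-! ### One-dimensional difference quotients -/

theorem abs_le_mul_pow_succ_of_hasDerivAt {g g' : ℝ → ℝ} {M h : ℝ} {n : ℕ}
    (hg : ∀ t, HasDerivAt g (g' t) t) (h0 : g 0 = 0) (hM : 0 ≤ M) (hh : 0 ≤ h)
    (hb : ∀ t ∈ Icc 0 h, |g' t| ≤ M * t ^ n) : |g h| ≤ M * h ^ (n + 1) := by
  have key := (convex_Icc (0 : ℝ) h).norm_image_sub_le_of_norm_hasDerivWithin_le
    (f := g) (f' := g') (C := M * h ^ n) (fun t _ => (hg t).hasDerivWithinAt)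
    (fun t ht => (hb t ht).trans (by
      have := ht.1
      have := ht.2
      gcongr)) (left_mem_Icc.2 hh) (right_mem_Icc.2 hh)
  rw [h0, sub_zero, sub_zero, Real.norm_eq_abs, Real.norm_eq_abs, abs_of_nonneg hh] at key
  calc |g h| ≤ M * h ^ n * h := key
    _ = M * h ^ (n + 1) := by ring

theorem hasDerivAt_add_reflect {f : ℝ → ℝ} (hf : Differentiable ℝ f) (x t : ℝ) :
    HasDerivAt (fun t => f (x + t) + f (x - t)) (deriv f (x + t) - deriv f (x - t)) t := by
  have h1 := (hf (x + t)).hasDerivAt.comp_const_add x t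
  have h2 := (hf (x - t)).hasDerivAt.comp_const_sub x t
  exact (h1.add h2).congr_deriv (by ring)

theorem hasDerivAt_sub_reflect {f : ℝ → ℝ} (hf : Differentiable ℝ f) (x t : ℝ) :
    HasDerivAt (fun t => f (x + t) - f (x - t)) (deriv f (x + t) + deriv f (x - t)) t := by
  have h1 := (hf (x + t)).hasDerivAt.comp_const_add x t
  have h2 := (hf (x - t)).hasDerivAt.comp_const_sub x t
  exact (h1.sub h2).congr_deriv (by ring)

theorem ContDiff.deriv_of_add_one_le {f : ℝ → ℝ} {m n : WithTop ℕ∞} (hf : ContDiff ℝ n f)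
    (h : m + 1 ≤ n) : ContDiff ℝ m (deriv f) :=
  ((contDiff_succ_iff_deriv (n := m)).1 (hf.of_le h)).2.2

section Reflect

variable {f : ℝ → ℝ} {x M h : ℝ}

theorem abs_sub_reflect_le (hf : Differentiable ℝ f)
    (hM : ∀ y, |y - x| ≤ 1 → |deriv f y| ≤ M) (hh : h ∈ Icc (0 : ℝ) 1) :
    |f (x + h) - f (x - h)| ≤ 2 * M * h := by
  have hM0 : 0 ≤ M := (abs_nonneg _).trans (hM x (by simp))
  have := abs_le_mul_pow_succ_of_hasDerivAt (n := 0) (M := 2 * M)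
    (fun t => hasDerivAt_sub_reflect hf x t)
    (by simp) (by positivity) hh.1 (fun t ht => by
      have ht1 : |t| ≤ 1 := abs_le.2 ⟨by linarith [ht.1], ht.2.trans hh.2⟩
      have h1 := hM (x + t) (by simpa using ht1)
      have h2 := hM (x - t) (by simpa using ht1)
      refine (abs_add_le _ _).trans ?_
      linarith)
  simpa using this

theorem abs_add_reflect_sub_le (hf : ContDiff ℝ 2 f)
    (hM : ∀ y, |y - x| ≤ 1 → |deriv (deriv f) y| ≤ M) (hh : h ∈ Icc (0 : ℝ) 1) :
    |f (x + h) + f (x - h) - 2 * f x| ≤ 2 * M * h ^ 2 := by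
  have hM0 : 0 ≤ M := (abs_nonneg _).trans (hM x (by simp))
  refine abs_le_mul_pow_succ_of_hasDerivAt (n := 1) (M := 2 * M)
    (fun t => (hasDerivAt_add_reflect (hf.differentiable two_ne_zero) x t).sub_const (2 * f x))
    (by simp; ring) (by positivity) hh.1 (fun t ht => ?_)
  simpa using abs_sub_reflect_le
    ((hf.deriv_of_add_one_le (m := 1) (by norm_num)).differentiable one_ne_zero) hM
    ⟨ht.1, ht.2.trans hh.2⟩

theorem abs_sub_reflect_sub_le (hf : ContDiff ℝ 3 f)
    (hM : ∀ y, |y - x| ≤ 1 → |deriv (deriv (deriv f)) y| ≤ M) (hh : h ∈ Icc (0 : ℝ) 1) :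
    |f (x + h) - f (x - h) - 2 * h * deriv f x| ≤ 2 * M * h ^ 3 := by
  have hM0 : 0 ≤ M := (abs_nonneg _).trans (hM x (by simp))
  refine abs_le_mul_pow_succ_of_hasDerivAt (n := 2) (M := 2 * M)
    (fun t => (hasDerivAt_sub_reflect (hf.differentiable three_ne_zero) x t).sub
      (((hasDerivAt_id t).const_mul 2).mul_const (deriv f x)))
    (by simp) (by positivity) hh.1 (fun t ht => ?_)
  simpa using abs_add_reflect_sub_le (hf.deriv_of_add_one_le (by norm_num)) hM
    ⟨ht.1, ht.2.trans hh.2⟩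

theorem abs_add_reflect_sub_sub_le (hf : ContDiff ℝ 4 f)
    (hM : ∀ y, |y - x| ≤ 1 → |deriv (deriv (deriv (deriv f))) y| ≤ M)
    (hh : h ∈ Icc (0 : ℝ) 1) :
    |f (x + h) + f (x - h) - 2 * f x - h ^ 2 * deriv (deriv f) x| ≤ 2 * M * h ^ 4 := by
  have hM0 : 0 ≤ M := (abs_nonneg _).trans (hM x (by simp))
  refine abs_le_mul_pow_succ_of_hasDerivAt (n := 3) (M := 2 * M)
    (fun t => ((hasDerivAt_add_reflect (hf.differentiable four_ne_zero) x t).sub_const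
      (2 * f x)).sub (((hasDerivAt_pow 2 t)).mul_const (deriv (deriv f) x)))
    (by simp; ring) (by positivity) hh.1 (fun t ht => ?_)
  simpa using abs_sub_reflect_sub_le (hf.deriv_of_add_one_le (by norm_num)) hM
    ⟨ht.1, ht.2.trans hh.2⟩

theorem abs_sub_reflect_sub_sub_le (hf : ContDiff ℝ 5 f)
    (hM : ∀ y, |y - x| ≤ 1 → |deriv (deriv (deriv (deriv (deriv f)))) y| ≤ M)
    (hh : h ∈ Icc (0 : ℝ) 1) :
    |f (x + h) - f (x - h) - 2 * h * deriv f x - h ^ 3 * (deriv (deriv (deriv f)) x / 3)|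
      ≤ 2 * M * h ^ 5 := by
  have hM0 : 0 ≤ M := (abs_nonneg _).trans (hM x (by simp))
  refine abs_le_mul_pow_succ_of_hasDerivAt (n := 4) (M := 2 * M)
    (fun t => ((hasDerivAt_sub_reflect (hf.differentiable (by norm_num)) x t).sub
      (((hasDerivAt_id t).const_mul 2).mul_const (deriv f x))).sub
      ((hasDerivAt_pow 3 t).mul_const (deriv (deriv (deriv f)) x / 3)))
    (by simp) (by positivity) hh.1 (fun t ht => ?_)
  convert abs_add_reflect_sub_sub_le (hf.deriv_of_add_one_le (by norm_num)) hM
    ⟨ht.1, ht.2.trans hh.2⟩ using 2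
  push_cast
  ring

theorem abs_centralDiff_le (hf : Differentiable ℝ f)
    (hM : ∀ y, |y - x| ≤ 1 → |deriv f y| ≤ M) (hh : h ∈ Ioc (0 : ℝ) 1) :
    |(f (x + h) - f (x - h)) / (2 * h)| ≤ M := by
  have h0 := hh.1
  have := abs_sub_reflect_le hf hM (Ioc_subset_Icc_self hh)
  rw [abs_div, abs_of_pos (by positivity : 0 < 2 * h), div_le_iff₀ (by positivity)]
  linarith

theorem abs_centralDiff_sub_deriv_le (hf : ContDiff ℝ 3 f)
    (hM : ∀ y, |y - x| ≤ 1 → |deriv (deriv (deriv f)) y| ≤ M) (hh : h ∈ Ioc (0 : ℝ) 1) :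
    |(f (x + h) - f (x - h)) / (2 * h) - deriv f x| ≤ M * h ^ 2 := by
  have h0 := hh.1
  have := abs_sub_reflect_sub_le hf hM (Ioc_subset_Icc_self hh)
  rw [show (f (x + h) - f (x - h)) / (2 * h) - deriv f x
    = (f (x + h) - f (x - h) - 2 * h * deriv f x) / (2 * h) by field_simp,
    abs_div, abs_of_pos (by positivity : 0 < 2 * h), div_le_iff₀ (by positivity)]
  linarith

theorem abs_centralDiff_sub_deriv_sub_le (hf : ContDiff ℝ 5 f)
    (hM : ∀ y, |y - x| ≤ 1 → |deriv (deriv (deriv (deriv (deriv f)))) y| ≤ M)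
    (hh : h ∈ Ioc (0 : ℝ) 1) :
    |(f (x + h) - f (x - h)) / (2 * h) - deriv f x - h ^ 2 / 6 * deriv (deriv (deriv f)) x|
      ≤ M * h ^ 4 := by
  have h0 := hh.1
  have := abs_sub_reflect_sub_sub_le hf hM (Ioc_subset_Icc_self hh)
  rw [show (f (x + h) - f (x - h)) / (2 * h) - deriv f x
      - h ^ 2 / 6 * deriv (deriv (deriv f)) x
    = (f (x + h) - f (x - h) - 2 * h * deriv f x
      - h ^ 3 * (deriv (deriv (deriv f)) x / 3)) / (2 * h) by field_simp; ring,
    abs_div, abs_of_pos (by positivity : 0 < 2 * h), div_le_iff₀ (by positivity)]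
  linarith

theorem abs_secondDiff_sub_le (hf : ContDiff ℝ 4 f)
    (hM : ∀ y, |y - x| ≤ 1 → |deriv (deriv (deriv (deriv f))) y| ≤ M)
    (hh : h ∈ Ioc (0 : ℝ) 1) :
    |(f (x + h) - 2 * f x + f (x - h)) / h ^ 2 - deriv (deriv f) x| ≤ 2 * M * h ^ 2 := by
  have h0 := hh.1
  have := abs_add_reflect_sub_sub_le hf hM (Ioc_subset_Icc_self hh)
  rw [show (f (x + h) - 2 * f x + f (x - h)) / h ^ 2 - deriv (deriv f) x
    = (f (x + h) + f (x - h) - 2 * f x - h ^ 2 * deriv (deriv f) x) / h ^ 2 by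
      field_simp; ring,
    abs_div, abs_of_pos (by positivity : 0 < h ^ 2), div_le_iff₀ (by positivity)]
  linarith

end Reflect

/-! ### Partial derivatives of functions of two variables -/

/-- Joint `C^n` regularity of a function of two real variables. -/
def ContDiff₂ (n : WithTop ℕ∞) (f : ℝ → ℝ → ℝ) : Prop :=
  ContDiff ℝ n (fun p : ℝ × ℝ => f p.1 p.2)

namespace ContDiff₂

variable {f g : ℝ → ℝ → ℝ} {m n : WithTop ℕ∞}

theorem of_le (hf : ContDiff₂ n f) (h : m ≤ n) : ContDiff₂ m f := ContDiff.of_le hf h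

theorem mul (hf : ContDiff₂ n f) (hg : ContDiff₂ n g) :
    ContDiff₂ n (fun θ ω => f θ ω * g θ ω) := ContDiff.mul hf hg

theorem sub (hf : ContDiff₂ n f) (hg : ContDiff₂ n g) :
    ContDiff₂ n (fun θ ω => f θ ω - g θ ω) := ContDiff.sub hf hg

theorem const_mul (c : ℝ) (hf : ContDiff₂ n f) :
    ContDiff₂ n (fun θ ω => c * f θ ω) := ContDiff.mul contDiff_const hf

theorem div (hf : ContDiff₂ n f) (hg : ContDiff₂ n g) (h0 : ∀ θ ω, g θ ω ≠ 0) :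
    ContDiff₂ n (fun θ ω => f θ ω / g θ ω) := ContDiff.div hf hg fun p => h0 p.1 p.2

theorem slice_theta (hf : ContDiff₂ n f) (ω : ℝ) : ContDiff ℝ n (fun t => f t ω) :=
  ContDiff.comp (g := fun p : ℝ × ℝ => f p.1 p.2) hf (contDiff_id.prodMk contDiff_const)

theorem slice_omega (hf : ContDiff₂ n f) (θ : ℝ) : ContDiff ℝ n (fun t => f θ t) :=
  ContDiff.comp (g := fun p : ℝ × ℝ => f p.1 p.2) hf (contDiff_const.prodMk contDiff_id)

theorem hasDerivAt_theta (hf : ContDiff₂ n f) (hn : n ≠ 0) (θ ω : ℝ) :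
    HasDerivAt (fun t => f t ω) (pdTheta f θ ω) θ :=
  ((hf.slice_theta ω).differentiable hn θ).hasDerivAt

theorem hasDerivAt_omega (hf : ContDiff₂ n f) (hn : n ≠ 0) (θ ω : ℝ) :
    HasDerivAt (fun t => f θ t) (pdOmega f θ ω) ω :=
  ((hf.slice_omega θ).differentiable hn ω).hasDerivAt

theorem pdTheta_eq_fderiv (hf : ContDiff₂ n f) (hn : n ≠ 0) (θ ω : ℝ) :
    pdTheta f θ ω = fderiv ℝ (fun p : ℝ × ℝ => f p.1 p.2) (θ, ω) (1, 0) := by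
  have h1 : HasDerivAt (fun t : ℝ => (t, ω)) ((1 : ℝ), (0 : ℝ)) θ :=
    (hasDerivAt_id θ).prodMk (hasDerivAt_const θ ω)
  have h2 := (ContDiff.differentiable hf hn (θ, ω)).hasFDerivAt
  exact (h2.comp_hasDerivAt θ h1).deriv

theorem pdOmega_eq_fderiv (hf : ContDiff₂ n f) (hn : n ≠ 0) (θ ω : ℝ) :
    pdOmega f θ ω = fderiv ℝ (fun p : ℝ × ℝ => f p.1 p.2) (θ, ω) (0, 1) := by
  have h1 : HasDerivAt (fun t : ℝ => (θ, t)) ((0 : ℝ), (1 : ℝ)) ω :=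
    (hasDerivAt_const ω θ).prodMk (hasDerivAt_id ω)
  have h2 := (ContDiff.differentiable hf hn (θ, ω)).hasFDerivAt
  exact (h2.comp_hasDerivAt ω h1).deriv

theorem ne_zero_of_add_one_le (h : m + 1 ≤ n) : n ≠ 0 := by
  rintro rfl
  simp at h

theorem pdTheta (hf : ContDiff₂ n f) (h : m + 1 ≤ n) : ContDiff₂ m (pdTheta f) := by
  have key : ContDiff ℝ m fun p : ℝ × ℝ =>
      fderiv ℝ (fun p : ℝ × ℝ => f p.1 p.2) p ((1 : ℝ), (0 : ℝ)) :=
    (ContDiff.fderiv_right hf h).clm_apply contDiff_const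
  have heq : (fun p : ℝ × ℝ => _root_.pdTheta f p.1 p.2) = _ :=
    funext fun p => hf.pdTheta_eq_fderiv (ne_zero_of_add_one_le h) p.1 p.2
  rw [ContDiff₂, heq]
  exact key

theorem pdOmega (hf : ContDiff₂ n f) (h : m + 1 ≤ n) : ContDiff₂ m (pdOmega f) := by
  have key : ContDiff ℝ m fun p : ℝ × ℝ =>
      fderiv ℝ (fun p : ℝ × ℝ => f p.1 p.2) p ((0 : ℝ), (1 : ℝ)) :=
    (ContDiff.fderiv_right hf h).clm_apply contDiff_const
  have heq : (fun p : ℝ × ℝ => _root_.pdOmega f p.1 p.2) = _ :=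
    funext fun p => hf.pdOmega_eq_fderiv (ne_zero_of_add_one_le h) p.1 p.2
  rw [ContDiff₂, heq]
  exact key

theorem pdTheta_pdOmega_comm (hf : ContDiff₂ n f) (h : 2 ≤ n) :
    _root_.pdTheta (_root_.pdOmega f) = _root_.pdOmega (_root_.pdTheta f) := by
  have h2 : ContDiff₂ 2 f := hf.of_le h
  have hd : Differentiable ℝ (fderiv ℝ (fun p : ℝ × ℝ => f p.1 p.2)) :=
    (ContDiff.fderiv_right (m := 1) h2 (by norm_num)).differentiable one_ne_zero
  have hsymm : ∀ p : ℝ × ℝ, IsSymmSndFDerivAt ℝ (fun p : ℝ × ℝ => f p.1 p.2) p := fun p =>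
    (ContDiff.contDiffAt h2).isSymmSndFDerivAt (by simp)
  have e : ∀ v w : ℝ × ℝ, ∀ p, fderiv ℝ
      (fun p : ℝ × ℝ => fderiv ℝ (fun p : ℝ × ℝ => f p.1 p.2) p v) p w
      = fderiv ℝ (fderiv ℝ (fun p : ℝ × ℝ => f p.1 p.2)) p w v := by
    intro v w p
    rw [fderiv_clm_apply (hd p) (differentiableAt_const v)]
    simp
  funext θ ω
  rw [(h2.pdOmega (m := 1) (by norm_num)).pdTheta_eq_fderiv one_ne_zero,
    (h2.pdTheta (m := 1) (by norm_num)).pdOmega_eq_fderiv one_ne_zero]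
  simp only [h2.pdOmega_eq_fderiv two_ne_zero, h2.pdTheta_eq_fderiv two_ne_zero]
  rw [e, e]
  exact (hsymm _).eq _ _

/-- A continuous function is bounded on squares centred at the origin. -/
theorem exists_bound (hf : ContDiff₂ n f) (R : ℝ) :
    ∃ C, ∀ θ ω, |θ| ≤ R → |ω| ≤ R → |f θ ω| ≤ C := by
  obtain ⟨C, hC⟩ := (isCompact_Icc.prod isCompact_Icc :
    IsCompact (Icc (-R) R ×ˢ Icc (-R) R)).exists_bound_of_continuousOn
      (ContDiff.continuous hf).continuousOn
  exact ⟨C, fun θ ω hθ hω => hC (θ, ω) ⟨abs_le.1 hθ, abs_le.1 hω⟩⟩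

end ContDiff₂

theorem abs_le_add_one_of_abs_sub_le {x y R : ℝ} (hx : |x| ≤ R) (h : |y - x| ≤ 1) :
    |y| ≤ R + 1 := by
  have := abs_add_le (y - x) x
  rw [sub_add_cancel] at this
  linarith

section Consistency

variable {f : ℝ → ℝ → ℝ}

theorem exists_abs_dscNablaTheta_sub_le (hf : ContDiff₂ 3 f) (R : ℝ) :
    ∃ C, ∀ θ ω, |θ| ≤ R → |ω| ≤ R → ∀ h ∈ Ioc (0 : ℝ) 1,
      |dscNablaTheta h f θ ω - pdTheta f θ ω| ≤ C * h ^ 2 := by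
  obtain ⟨C, hC⟩ := (((hf.pdTheta (m := 2) (by norm_num)).pdTheta (m := 1)
    (by norm_num)).pdTheta (m := 0) (by norm_num)).exists_bound (R + 1)
  exact ⟨C, fun θ ω hθ hω h hh => abs_centralDiff_sub_deriv_le (hf.slice_theta ω)
    (fun y hy => hC y ω (abs_le_add_one_of_abs_sub_le hθ hy) (by linarith)) hh⟩

theorem exists_abs_dscNablaTheta_sub_sub_le (hf : ContDiff₂ 5 f) (R : ℝ) :
    ∃ C, ∀ θ ω, |θ| ≤ R → |ω| ≤ R → ∀ h ∈ Ioc (0 : ℝ) 1,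
      |dscNablaTheta h f θ ω - pdTheta f θ ω
        - h ^ 2 / 6 * pdTheta (pdTheta (pdTheta f)) θ ω| ≤ C * h ^ 4 := by
  obtain ⟨C, hC⟩ := (((((hf.pdTheta (m := 4) (by norm_num)).pdTheta (m := 3)
    (by norm_num)).pdTheta (m := 2) (by norm_num)).pdTheta (m := 1) (by norm_num)).pdTheta
    (m := 0) (by norm_num)).exists_bound (R + 1)
  exact ⟨C, fun θ ω hθ hω h hh => abs_centralDiff_sub_deriv_sub_le (hf.slice_theta ω)
    (fun y hy => hC y ω (abs_le_add_one_of_abs_sub_le hθ hy) (by linarith)) hh⟩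

theorem exists_abs_dscThetaSq_sub_le (hf : ContDiff₂ 4 f) (R : ℝ) :
    ∃ C, ∀ θ ω, |θ| ≤ R → |ω| ≤ R → ∀ h ∈ Ioc (0 : ℝ) 1,
      |dscThetaSq h f θ ω - pdTheta (pdTheta f) θ ω| ≤ C * h ^ 2 := by
  obtain ⟨C, hC⟩ := ((((hf.pdTheta (m := 3) (by norm_num)).pdTheta (m := 2)
    (by norm_num)).pdTheta (m := 1) (by norm_num)).pdTheta
    (m := 0) (by norm_num)).exists_bound (R + 1)
  exact ⟨2 * C, fun θ ω hθ hω h hh => abs_secondDiff_sub_le (hf.slice_theta ω)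
    (fun y hy => hC y ω (abs_le_add_one_of_abs_sub_le hθ hy) (by linarith)) hh⟩

theorem exists_abs_dscOmegaSq_sub_le (hf : ContDiff₂ 4 f) (R : ℝ) :
    ∃ C, ∀ θ ω, |θ| ≤ R → |ω| ≤ R → ∀ h ∈ Ioc (0 : ℝ) 1,
      |dscOmegaSq h f θ ω - pdOmega (pdOmega f) θ ω| ≤ C * h ^ 2 := by
  obtain ⟨C, hC⟩ := ((((hf.pdOmega (m := 3) (by norm_num)).pdOmega (m := 2)
    (by norm_num)).pdOmega (m := 1) (by norm_num)).pdOmega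
    (m := 0) (by norm_num)).exists_bound (R + 1)
  exact ⟨2 * C, fun θ ω hθ hω h hh => abs_secondDiff_sub_le (hf.slice_omega θ)
    (fun y hy => hC θ y (by linarith) (abs_le_add_one_of_abs_sub_le hω hy)) hh⟩

/-- Central ω-difference at a point. -/
noncomputable def dscNablaOmega (h : ℝ) (g : ℝ → ℝ → ℝ) (θ ω : ℝ) : ℝ :=
  (g θ (ω + h) - g θ (ω - h)) / (2 * h)

theorem exists_abs_dscNablaOmega_sub_le (hf : ContDiff₂ 3 f) (R : ℝ) :
    ∃ C, ∀ θ ω, |θ| ≤ R → |ω| ≤ R → ∀ h ∈ Ioc (0 : ℝ) 1,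
      |dscNablaOmega h f θ ω - pdOmega f θ ω| ≤ C * h ^ 2 := by
  obtain ⟨C, hC⟩ := (((hf.pdOmega (m := 2) (by norm_num)).pdOmega (m := 1)
    (by norm_num)).pdOmega (m := 0) (by norm_num)).exists_bound (R + 1)
  exact ⟨C, fun θ ω hθ hω h hh => abs_centralDiff_sub_deriv_le (hf.slice_omega θ)
    (fun y hy => hC θ y (by linarith) (abs_le_add_one_of_abs_sub_le hω hy)) hh⟩

theorem exists_abs_dscNablaOmega_sub_sub_le (hf : ContDiff₂ 5 f) (R : ℝ) :
    ∃ C, ∀ θ ω, |θ| ≤ R → |ω| ≤ R → ∀ h ∈ Ioc (0 : ℝ) 1,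
      |dscNablaOmega h f θ ω - pdOmega f θ ω
        - h ^ 2 / 6 * pdOmega (pdOmega (pdOmega f)) θ ω| ≤ C * h ^ 4 := by
  obtain ⟨C, hC⟩ := (((((hf.pdOmega (m := 4) (by norm_num)).pdOmega (m := 3)
    (by norm_num)).pdOmega (m := 2) (by norm_num)).pdOmega (m := 1) (by norm_num)).pdOmega
    (m := 0) (by norm_num)).exists_bound (R + 1)
  exact ⟨C, fun θ ω hθ hω h hh => abs_centralDiff_sub_deriv_sub_le (hf.slice_omega θ)
    (fun y hy => hC θ y (by linarith) (abs_le_add_one_of_abs_sub_le hω hy)) hh⟩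

end Consistency

section Product

variable {w : ℝ → ℝ → ℝ} {G G' : ℝ → ℝ → ℝ → ℝ} {R : ℝ} {k : ℕ}

/-- If `G` and its ω-derivative are `O(h ^ k)`, then so is the central ω-difference of `w * G`. -/
theorem exists_abs_dscNablaOmega_mul_le (hw : ContDiff₂ 1 w)
    (hG : ∀ h θ ω, HasDerivAt (fun t => G h θ t) (G' h θ ω) ω)
    (hb : ∃ C, ∀ θ ω, |θ| ≤ R + 1 → |ω| ≤ R + 1 → ∀ h ∈ Ioc (0 : ℝ) 1,
      |G h θ ω| ≤ C * h ^ k)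
    (hb' : ∃ C, ∀ θ ω, |θ| ≤ R + 1 → |ω| ≤ R + 1 → ∀ h ∈ Ioc (0 : ℝ) 1,
      |G' h θ ω| ≤ C * h ^ k) :
    ∃ C, ∀ θ ω, |θ| ≤ R → |ω| ≤ R → ∀ a ∈ Ioc (0 : ℝ) 1, ∀ b ∈ Ioc (0 : ℝ) 1,
      |dscNablaOmega b (fun θ ω => w θ ω * G a θ ω) θ ω| ≤ C * a ^ k := by
  obtain ⟨C, hC⟩ := hb
  obtain ⟨C', hC'⟩ := hb'
  obtain ⟨M, hM⟩ := hw.exists_bound (R + 1)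
  obtain ⟨M', hM'⟩ := (hw.pdOmega (m := 0) (by norm_num)).exists_bound (R + 1)
  refine ⟨M' * C + M * C', fun θ ω hθ hω a ha b hb => ?_⟩
  have hd : ∀ t, HasDerivAt (fun t => w θ t * G a θ t)
      (pdOmega w θ t * G a θ t + w θ t * G' a θ t) t := fun t =>
    (hw.hasDerivAt_omega one_ne_zero θ t).mul (hG a θ t)
  refine abs_centralDiff_le (f := fun t => w θ t * G a θ t)
    (fun t => (hd t).differentiableAt) (fun y hy => ?_) hb
  have hθ' : |θ| ≤ R + 1 := by linarith
  have hy' := abs_le_add_one_of_abs_sub_le hω hy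
  have hM0 := (abs_nonneg _).trans (hM θ y hθ' hy')
  have hM0' := (abs_nonneg _).trans (hM' θ y hθ' hy')
  rw [(hd y).deriv]
  calc _ ≤ |pdOmega w θ y * G a θ y| + |w θ y * G' a θ y| := abs_add_le _ _
    _ ≤ M' * (C * a ^ k) + M * (C' * a ^ k) := by
      rw [abs_mul, abs_mul]
      gcongr
      exacts [hM' θ y hθ' hy', hC θ y hθ' hy' a ha, hM θ y hθ' hy', hC' θ y hθ' hy' a ha]
    _ = _ := by ring

end Product

theorem ContDiff₂.hasDerivAt_dscNablaTheta {u : ℝ → ℝ → ℝ} {n : WithTop ℕ∞}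
    (hu : ContDiff₂ n u) (hn : n ≠ 0) (h θ ω : ℝ) :
    HasDerivAt (fun t => dscNablaTheta h u θ t) (dscNablaTheta h (_root_.pdOmega u) θ ω) ω :=
  ((hu.hasDerivAt_omega hn (θ + h) ω).sub (hu.hasDerivAt_omega hn (θ - h) ω)).div_const _

theorem hasDerivAt_dscNablaTheta_sub {u : ℝ → ℝ → ℝ} (hu : ContDiff₂ 2 u) (h θ ω : ℝ) :
    HasDerivAt (fun t => dscNablaTheta h u θ t - pdTheta u θ t)
      (dscNablaTheta h (pdOmega u) θ ω - pdTheta (pdOmega u) θ ω) ω := by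
  rw [hu.pdTheta_pdOmega_comm le_rfl]
  exact (hu.hasDerivAt_dscNablaTheta two_ne_zero h θ ω).sub
    ((hu.pdTheta (m := 1) (by norm_num)).hasDerivAt_omega one_ne_zero θ ω)

theorem hasDerivAt_dscNablaTheta_sub_sub {u : ℝ → ℝ → ℝ} (hu : ContDiff₂ 4 u) (h θ ω : ℝ) :
    HasDerivAt (fun t => dscNablaTheta h u θ t - pdTheta u θ t
        - h ^ 2 / 6 * pdTheta (pdTheta (pdTheta u)) θ t)
      (dscNablaTheta h (pdOmega u) θ ω - pdTheta (pdOmega u) θ ω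
        - h ^ 2 / 6 * pdTheta (pdTheta (pdTheta (pdOmega u))) θ ω) ω := by
  have h3 : ContDiff₂ 3 (pdTheta u) := hu.pdTheta (by norm_num)
  have h2 : ContDiff₂ 2 (pdTheta (pdTheta u)) := h3.pdTheta (by norm_num)
  refine (hasDerivAt_dscNablaTheta_sub (hu.of_le (by norm_num)) h θ ω).sub ?_
  rw [hu.pdTheta_pdOmega_comm (by norm_num), h3.pdTheta_pdOmega_comm (by norm_num),
    h2.pdTheta_pdOmega_comm le_rfl]
  exact ((h2.pdTheta (m := 1) (by norm_num)).hasDerivAt_omega one_ne_zero θ ω).const_mul _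

/-! ### The algebraic identities behind the scheme -/

theorem qTilde1_eq (q : ℝ → ℝ → ℝ) : qTilde1 q = fun θ ω =>
    pdTheta q θ ω * pdTheta q θ ω / q θ ω - 1 / 2 * pdTheta (pdTheta q) θ ω := by
  funext θ ω
  rw [qTilde1, iteratedDeriv_succ, iteratedDeriv_one, pow_two]
  rfl

theorem ContDiff₂.qTilde1 {q : ℝ → ℝ → ℝ} {n m : WithTop ℕ∞} (hq : ContDiff₂ n q)
    (hqpos : ∀ θ ω, 0 < q θ ω) (h : m + 1 + 1 ≤ n) : ContDiff₂ m (qTilde1 q) := by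
  have h1 : ContDiff₂ (m + 1) (_root_.pdTheta q) := hq.pdTheta h
  have h1' : ContDiff₂ m (_root_.pdTheta q) := h1.of_le le_self_add
  rw [qTilde1_eq]
  exact ((h1'.mul h1').div (hq.of_le ((le_self_add.trans le_self_add).trans h))
    fun θ ω => (hqpos θ ω).ne').sub ((h1.pdTheta le_rfl).const_mul _)

/-- The coefficient of `h_θ² / 6` in the expansion of `q̂₁ ∇_θ u`. -/
noncomputable def mixedCorrection (u q : ℝ → ℝ → ℝ) (θ ω : ℝ) : ℝ :=
  q θ ω * pdTheta (pdTheta (pdTheta u)) θ ω - 2 * (qTilde1 q θ ω * pdTheta u θ ω)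

theorem dscMixed_eq (u q : ℝ → ℝ → ℝ) (a b θ ω : ℝ) :
    dscMixed u q a b θ ω =
      dscNablaOmega b (fun θ ω => q θ ω * pdTheta u θ ω) θ ω
      + a ^ 2 / 6 * dscNablaOmega b (mixedCorrection u q) θ ω
      + dscNablaOmega b (fun θ ω => q θ ω * (dscNablaTheta a u θ ω - pdTheta u θ ω
          - a ^ 2 / 6 * pdTheta (pdTheta (pdTheta u)) θ ω)) θ ω
      - a ^ 2 / 3 * dscNablaOmega b (fun θ ω => qTilde1 q θ ω *
          (dscNablaTheta a u θ ω - pdTheta u θ ω)) θ ω := by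
  simp only [dscMixed, dscNablaOmega, mixedCorrection, qHat1, dscNablaTheta]
  ring

theorem dscSecond_eq (u q : ℝ → ℝ → ℝ) {a : ℝ} (ha : a ≠ 0) (θ ω : ℝ) :
    dscSecond u q a θ ω =
      (q θ ω + a ^ 2 / 8 * dscThetaSq (a / 2) q θ ω) * dscThetaSq a u θ ω
      + dscNablaTheta (a / 2) q θ ω * dscNablaTheta a u θ ω := by
  simp only [dscSecond, dscThetaSq, dscNablaTheta]
  field_simp
  ring

theorem pdTheta_mul {f g : ℝ → ℝ → ℝ} (hf : ContDiff₂ 1 f) (hg : ContDiff₂ 1 g) :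
    pdTheta (fun θ ω => f θ ω * g θ ω) =
      fun θ ω => pdTheta f θ ω * g θ ω + f θ ω * pdTheta g θ ω := by
  funext θ ω
  exact ((hf.hasDerivAt_theta one_ne_zero θ ω).mul
    (hg.hasDerivAt_theta one_ne_zero θ ω)).deriv

theorem pdTheta_add {f g : ℝ → ℝ → ℝ} (hf : ContDiff₂ 1 f) (hg : ContDiff₂ 1 g) :
    pdTheta (fun θ ω => f θ ω + g θ ω) = fun θ ω => pdTheta f θ ω + pdTheta g θ ω := by
  funext θ ω
  exact ((hf.hasDerivAt_theta one_ne_zero θ ω).add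
    (hg.hasDerivAt_theta one_ne_zero θ ω)).deriv

/-- The second-order terms of the two sides of the scheme agree. -/
theorem pdTheta_pdTheta_vTilde_sub {u q : ℝ → ℝ → ℝ} (hu : ContDiff₂ 6 u) (hq : ContDiff₂ 6 q)
    (hqpos : ∀ θ ω, 0 < q θ ω) (θ ω : ℝ) :
    pdTheta (pdTheta (vTilde u q)) θ ω / 6
      - pdTheta q θ ω / q θ ω * pdTheta (vTilde u q) θ ω / 3 =
    pdOmega (mixedCorrection u q) θ ω / 6 + qBar q θ ω *
      (pdTheta q θ ω * pdTheta u θ ω + q θ ω * pdTheta (pdTheta u) θ ω) / 3 := by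
  have hu1 : ContDiff₂ 5 (pdTheta u) := hu.pdTheta (by norm_num)
  have hu2 : ContDiff₂ 4 (pdTheta (pdTheta u)) := hu1.pdTheta (by norm_num)
  have hu3 : ContDiff₂ 3 (pdTheta (pdTheta (pdTheta u))) := hu2.pdTheta (by norm_num)
  have hq1 : ContDiff₂ 5 (pdTheta q) := hq.pdTheta (by norm_num)
  have hq2 : ContDiff₂ 4 (pdTheta (pdTheta q)) := hq1.pdTheta (by norm_num)
  have hA : ContDiff₂ 5 (fun θ ω => q θ ω * pdTheta u θ ω) :=
    (hq.of_le (by norm_num)).mul hu1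
  have hA1 : ContDiff₂ 4 (pdTheta fun θ ω => q θ ω * pdTheta u θ ω) := hA.pdTheta (by norm_num)
  have hv : vTilde u q = pdOmega fun θ ω => q θ ω * pdTheta u θ ω := rfl
  rw [hv, hA.pdTheta_pdOmega_comm (by norm_num), hA1.pdTheta_pdOmega_comm (by norm_num),
    pdTheta_mul (hq.of_le (by norm_num)) (hu1.of_le (by norm_num)),
    pdTheta_add ((hq1.of_le (by norm_num)).mul (hu1.of_le (by norm_num)))
      ((hq.of_le (by norm_num)).mul (hu2.of_le (by norm_num))),
    pdTheta_mul (hq1.of_le (by norm_num)) (hu1.of_le (by norm_num)),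
    pdTheta_mul (hq.of_le (by norm_num)) (hu2.of_le (by norm_num))]
  have dq := hq.hasDerivAt_omega (by norm_num) θ ω
  have dq1 := hq1.hasDerivAt_omega (by norm_num) θ ω
  have dq2 := hq2.hasDerivAt_omega (by norm_num) θ ω
  have du1 := hu1.hasDerivAt_omega (by norm_num) θ ω
  have du2 := hu2.hasDerivAt_omega (by norm_num) θ ω
  have du3 := hu3.hasDerivAt_omega (by norm_num) θ ω
  have hq0 : q θ ω ≠ 0 := (hqpos θ ω).ne'
  have e1 := (((dq2.mul du1).add (dq1.mul du2)).add ((dq1.mul du2).add (dq.mul du3))).deriv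
  have e2 := ((dq1.mul du1).add (dq.mul du2)).deriv
  have e3 := ((dq.mul du3).sub
    (((((dq1.mul dq1).div dq hq0).sub (dq2.const_mul (1 / 2))).mul du1).const_mul 2)).deriv
  have e4 := (dq1.div dq hq0).deriv
  have hm : mixedCorrection u q = fun θ ω => q θ ω * pdTheta (pdTheta (pdTheta u)) θ ω
      - 2 * ((pdTheta q θ ω * pdTheta q θ ω / q θ ω - 1 / 2 * pdTheta (pdTheta q) θ ω)
        * pdTheta u θ ω) := by
    funext θ ω
    rw [mixedCorrection, qTilde1_eq]
  rw [hm, show pdOmega (fun θ ω => q θ ω * pdTheta (pdTheta (pdTheta u)) θ ω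
      - 2 * ((pdTheta q θ ω * pdTheta q θ ω / q θ ω - 1 / 2 * pdTheta (pdTheta q) θ ω)
        * pdTheta u θ ω)) θ ω = _ from e3, show qBar q θ ω = _ from e4,
    show pdOmega (fun θ ω => pdTheta (pdTheta q) θ ω * pdTheta u θ ω
      + pdTheta q θ ω * pdTheta (pdTheta u) θ ω + (pdTheta q θ ω * pdTheta (pdTheta u) θ ω
      + q θ ω * pdTheta (pdTheta (pdTheta u)) θ ω)) θ ω = _ from e1,
    show pdOmega (fun θ ω => pdTheta q θ ω * pdTheta u θ ω
      + q θ ω * pdTheta (pdTheta u) θ ω) θ ω = _ from e2]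
  simp only [Pi.mul_apply, Pi.div_apply, Pi.sub_apply]
  field_simp
  ring

/-! ### Uniform asymptotics on bounded sets -/

/-- The points `(θ, ω, h_θ, h_ω)` with `|θ|, |ω| ≤ R` and step sizes in `(0, 1]`. -/
def paramBox (R : ℝ) : Set (ℝ × ℝ × ℝ × ℝ) :=
  {p | |p.1| ≤ R ∧ |p.2.1| ≤ R ∧ p.2.2.1 ∈ Ioc (0 : ℝ) 1 ∧ p.2.2.2 ∈ Ioc (0 : ℝ) 1}

/-- The larger of the two step sizes. -/
noncomputable def maxStep (p : ℝ × ℝ × ℝ × ℝ) : ℝ := max p.2.2.1 p.2.2.2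

section Asymptotics

variable {R : ℝ}

theorem isBigO_paramBox {F : ℝ × ℝ × ℝ × ℝ → ℝ} {k : ℕ} (C : ℝ)
    (h : ∀ p ∈ paramBox R, |F p| ≤ C * p.2.2.1 ^ k ∨ |F p| ≤ C * p.2.2.2 ^ k) :
    F =O[𝓟 (paramBox R)] fun p => maxStep p ^ k := by
  refine IsBigO.of_bound |C| (eventually_principal.2 fun p hp => ?_)
  have ha : 0 ≤ p.2.2.1 := hp.2.2.1.1.le
  have hb : 0 ≤ p.2.2.2 := hp.2.2.2.1.le
  have ha' : p.2.2.1 ≤ maxStep p := le_max_left _ _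
  have hb' : p.2.2.2 ≤ maxStep p := le_max_right _ _
  rw [Real.norm_eq_abs, Real.norm_eq_abs, abs_of_nonneg (pow_nonneg (ha.trans ha') k)]
  rcases h p hp with h | h
  · refine h.trans ?_
    gcongr
    exact le_abs_self C
  · refine h.trans ?_
    gcongr
    exact le_abs_self C

theorem isBigO_of_theta_bound {F : ℝ → ℝ → ℝ → ℝ} {k : ℕ}
    (h : ∃ C, ∀ θ ω, |θ| ≤ R → |ω| ≤ R → ∀ h ∈ Ioc (0 : ℝ) 1, |F h θ ω| ≤ C * h ^ k) :
    (fun p => F p.2.2.1 p.1 p.2.1) =O[𝓟 (paramBox R)] fun p => maxStep p ^ k := by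
  obtain ⟨C, hC⟩ := h
  exact isBigO_paramBox C fun p hp => Or.inl (hC _ _ hp.1 hp.2.1 _ hp.2.2.1)

theorem isBigO_of_omega_bound {F : ℝ → ℝ → ℝ → ℝ} {k : ℕ}
    (h : ∃ C, ∀ θ ω, |θ| ≤ R → |ω| ≤ R → ∀ h ∈ Ioc (0 : ℝ) 1, |F h θ ω| ≤ C * h ^ k) :
    (fun p => F p.2.2.2 p.1 p.2.1) =O[𝓟 (paramBox R)] fun p => maxStep p ^ k := by
  obtain ⟨C, hC⟩ := h
  exact isBigO_paramBox C fun p hp => Or.inr (hC _ _ hp.1 hp.2.1 _ hp.2.2.2)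

theorem isBigO_of_theta_omega_bound {F : ℝ → ℝ → ℝ → ℝ → ℝ} {k : ℕ}
    (h : ∃ C, ∀ θ ω, |θ| ≤ R → |ω| ≤ R → ∀ a ∈ Ioc (0 : ℝ) 1, ∀ b ∈ Ioc (0 : ℝ) 1,
      |F a b θ ω| ≤ C * a ^ k) :
    (fun p => F p.2.2.1 p.2.2.2 p.1 p.2.1) =O[𝓟 (paramBox R)] fun p => maxStep p ^ k := by
  obtain ⟨C, hC⟩ := h
  exact isBigO_paramBox C fun p hp => Or.inl (hC _ _ hp.1 hp.2.1 _ hp.2.2.1 _ hp.2.2.2)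

theorem ContDiff₂.isBigO_one {f : ℝ → ℝ → ℝ} {n : WithTop ℕ∞} (hf : ContDiff₂ n f) :
    (fun p => f p.1 p.2.1) =O[𝓟 (paramBox R)] fun _ => (1 : ℝ) := by
  obtain ⟨C, hC⟩ := hf.exists_bound R
  refine IsBigO.of_bound C (eventually_principal.2 fun p hp => ?_)
  simpa using hC _ _ hp.1 hp.2.1

theorem isBigO_maxStep_sq_one :
    (fun p => maxStep p ^ 2) =O[𝓟 (paramBox R)] fun _ => (1 : ℝ) := by
  refine IsBigO.of_bound 1 (eventually_principal.2 fun p hp => ?_)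
  have h0 : 0 ≤ maxStep p := hp.2.2.1.1.le.trans (le_max_left _ _)
  have h1 : maxStep p ≤ 1 := max_le hp.2.2.1.2 hp.2.2.2.2
  simpa [abs_of_nonneg h0] using h1

theorem isBigO_theta_step_sq (c : ℝ) :
    (fun p : ℝ × ℝ × ℝ × ℝ => p.2.2.1 ^ 2 / c) =O[𝓟 (paramBox R)] fun p => maxStep p ^ 2 :=
  isBigO_paramBox |1 / c| fun p _ => Or.inl (by
    rw [div_eq_mul_one_div, abs_mul, abs_of_nonneg (sq_nonneg p.2.2.1), mul_comm])

theorem isBigO_omega_step_sq (c : ℝ) :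
    (fun p : ℝ × ℝ × ℝ × ℝ => p.2.2.2 ^ 2 / c) =O[𝓟 (paramBox R)] fun p => maxStep p ^ 2 :=
  isBigO_paramBox |1 / c| fun p _ => Or.inr (by
    rw [div_eq_mul_one_div, abs_mul, abs_of_nonneg (sq_nonneg p.2.2.2), mul_comm])

theorem Asymptotics.IsBigO.mul_one_right {f g h : ℝ × ℝ × ℝ × ℝ → ℝ}
    {l : Filter (ℝ × ℝ × ℝ × ℝ)} (hf : f =O[l] h) (hg : g =O[l] fun _ => (1 : ℝ)) :
    (fun p => f p * g p) =O[l] h := by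
  simpa using hf.mul hg

theorem isBigO_dscSecond_sub {u q : ℝ → ℝ → ℝ} (hu : ContDiff₂ 4 u) (hq : ContDiff₂ 4 q) :
    (fun p => dscSecond u q p.2.2.1 p.1 p.2.1
      - (pdTheta q p.1 p.2.1 * pdTheta u p.1 p.2.1
        + q p.1 p.2.1 * pdTheta (pdTheta u) p.1 p.2.1))
      =O[𝓟 (paramBox R)] fun p => maxStep p ^ 2 := by
  have hu1 : ContDiff₂ 3 (pdTheta u) := hu.pdTheta (by norm_num)
  have hq1 : ContDiff₂ 3 (pdTheta q) := hq.pdTheta (by norm_num)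
  have hq2 : ContDiff₂ 2 (pdTheta (pdTheta q)) := hq1.pdTheta (by norm_num)
  have half : ∀ {F : ℝ → ℝ → ℝ → ℝ}, (∃ C, ∀ θ ω, |θ| ≤ R → |ω| ≤ R → ∀ h ∈ Ioc (0 : ℝ) 1,
      |F h θ ω| ≤ C * h ^ 2) → ∃ C, ∀ θ ω, |θ| ≤ R → |ω| ≤ R → ∀ h ∈ Ioc (0 : ℝ) 1,
      |F (h / 2) θ ω| ≤ C * h ^ 2 := by
    rintro F ⟨C, hC⟩
    refine ⟨C / 4, fun θ ω hθ hω h hh => ?_⟩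
    refine (hC θ ω hθ hω (h / 2) ⟨by linarith [hh.1], by linarith [hh.1, hh.2]⟩).trans_eq ?_
    ring
  have b1 := isBigO_of_theta_bound (exists_abs_dscNablaTheta_sub_le (hu.of_le (by norm_num)) R)
  have b2 := isBigO_of_theta_bound (exists_abs_dscThetaSq_sub_le hu R)
  have b3 := isBigO_of_theta_bound
    (half (exists_abs_dscNablaTheta_sub_le (hq.of_le (by norm_num)) R))
  have b4 := isBigO_of_theta_bound (half (exists_abs_dscThetaSq_sub_le hq R))
  have c1 := (b1.trans isBigO_maxStep_sq_one).add hu1.isBigO_one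
  have c2 := (b2.trans isBigO_maxStep_sq_one).add
    (hu1.pdTheta (m := 2) (by norm_num)).isBigO_one
  have c4 := (b4.trans isBigO_maxStep_sq_one).add hq2.isBigO_one
  refine ((((b2.mul_one_right hq.isBigO_one).add
    (((isBigO_theta_step_sq 8).mul_one_right c4).mul_one_right c2)).add
    (b3.mul_one_right c1)).add (b1.mul_one_right hq1.isBigO_one)).congr'
    (eventually_principal.2 fun p hp => ?_) EventuallyEq.rfl
  dsimp only
  rw [dscSecond_eq u q hp.2.2.1.1.ne']
  ring

theorem isBigO_compactC_sub {u q : ℝ → ℝ → ℝ} (hu : ContDiff₂ 6 u) (hq : ContDiff₂ 6 q)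
    (hqpos : ∀ θ ω, 0 < q θ ω) :
    (fun p => compactC u q p.2.2.1 p.2.2.2 p.1 p.2.1 - dscMixed u q p.2.2.1 p.2.2.2 p.1 p.2.1
      - p.2.2.1 ^ 2 / 3 * qBar q p.1 p.2.1 * dscSecond u q p.2.2.1 p.1 p.2.1)
      =O[𝓟 (paramBox R)] fun p => maxStep p ^ 4 := by
  have hu1 : ContDiff₂ 5 (pdTheta u) := hu.pdTheta (by norm_num)
  have hu3 : ContDiff₂ 3 (pdTheta (pdTheta (pdTheta u))) :=
    (hu1.pdTheta (m := 4) (by norm_num)).pdTheta (by norm_num)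
  have huo : ContDiff₂ 5 (pdOmega u) := hu.pdOmega (by norm_num)
  have hq1 : ContDiff₂ 5 (pdTheta q) := hq.pdTheta (by norm_num)
  have hqt : ContDiff₂ 4 (qTilde1 q) := hq.qTilde1 hqpos (by norm_num)
  have hA : ContDiff₂ 5 (fun θ ω => q θ ω * pdTheta u θ ω) :=
    (hq.of_le (by norm_num)).mul hu1
  have hv : ContDiff₂ 4 (vTilde u q) := hA.pdOmega (by norm_num)
  have hB : ContDiff₂ 3 (mixedCorrection u q) := ((hq.of_le (by norm_num)).mul hu3).sub
    (((hqt.of_le (by norm_num)).mul (hu1.of_le (by norm_num))).const_mul 2)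
  have hr : ContDiff₂ 5 (fun θ ω => pdTheta q θ ω / q θ ω) :=
    hq1.div (hq.of_le (by norm_num)) fun θ ω => (hqpos θ ω).ne'
  have hqb : ContDiff₂ 4 (qBar q) := hr.pdOmega (by norm_num)
  have hm : (fun p => maxStep p ^ 2 * maxStep p ^ 2) = fun p => maxStep p ^ 4 := by
    funext p
    ring
  have t1 := (isBigO_theta_step_sq (R := R) 6).mul
    (isBigO_of_theta_bound (exists_abs_dscThetaSq_sub_le hv R))
  have t2 := (isBigO_omega_step_sq (R := R) 6).mul
    (isBigO_of_omega_bound (exists_abs_dscOmegaSq_sub_le hv R))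
  have t3 := (isBigO_theta_step_sq (R := R) 3).mul ((isBigO_of_theta_bound
    (exists_abs_dscNablaTheta_sub_le (hv.of_le (by norm_num)) R)).mul_one_right hr.isBigO_one)
  have t4 := isBigO_of_omega_bound (exists_abs_dscNablaOmega_sub_sub_le hA R)
  have t5 := (isBigO_theta_step_sq (R := R) 6).mul
    (isBigO_of_omega_bound (exists_abs_dscNablaOmega_sub_le hB R))
  have t6 := isBigO_of_theta_omega_bound (exists_abs_dscNablaOmega_mul_le
    (hq.of_le (by norm_num)) (hasDerivAt_dscNablaTheta_sub_sub (hu.of_le (by norm_num)))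
    (exists_abs_dscNablaTheta_sub_sub_le (hu.of_le (by norm_num)) (R + 1))
    (exists_abs_dscNablaTheta_sub_sub_le huo (R + 1)))
  have t7 := (isBigO_theta_step_sq (R := R) 3).mul (isBigO_of_theta_omega_bound
    (exists_abs_dscNablaOmega_mul_le
    (hqt.of_le (by norm_num)) (hasDerivAt_dscNablaTheta_sub (hu.of_le (by norm_num)))
    (exists_abs_dscNablaTheta_sub_le (hu.of_le (by norm_num)) (R + 1))
    (exists_abs_dscNablaTheta_sub_le (huo.of_le (by norm_num)) (R + 1))))
  have t8 := (isBigO_theta_step_sq (R := R) 3).mul ((isBigO_dscSecond_sub (R := R)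
    (hu.of_le (by norm_num)) (hq.of_le (by norm_num))).mul_one_right hqb.isBigO_one)
  rw [hm] at t1 t2 t3 t5 t7 t8
  refine (((((((t1.add t2).sub t3).sub t4).sub t5).sub t6).add t7).sub t8).congr_left
    fun p => ?_
  have key := pdTheta_pdTheta_vTilde_sub hu hq hqpos p.1 p.2.1
  have hv1 : pdOmega (fun θ ω => q θ ω * pdTheta u θ ω) = vTilde u q := rfl
  rw [dscMixed_eq, compactC, hv1]
  linear_combination -p.2.2.1 ^ 2 * key

end Asymptotics

/-- Fourth-order accuracy of the compact operator `𝒞_{θω}` for the mixed derivative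
(Lemma 3.5, first identity): `𝒞ṽ = ∇_ω(q̂₁ ∇_θ u) + (h_θ²/3) q̄ δ_θ(q δ_θ u) + O(h⁴)`,
uniformly on compact sets. -/
theorem compactC_fourth_order
    (u q : ℝ → ℝ → ℝ)
    (hu : ContDiff ℝ 6 (fun p : ℝ × ℝ => u p.1 p.2))
    (hq : ContDiff ℝ 6 (fun p : ℝ × ℝ => q p.1 p.2))
    (hqpos : ∀ θ ω : ℝ, 0 < q θ ω) :
    ∀ K : Set (ℝ × ℝ), IsCompact K → ∃ C > 0, ∀ θ ω : ℝ, (θ, ω) ∈ K →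
      ∀ hθ ∈ Set.Ioc (0 : ℝ) 1, ∀ hω ∈ Set.Ioc (0 : ℝ) 1,
      |compactC u q hθ hω θ ω - dscMixed u q hθ hω θ ω
        - hθ ^ 2 / 3 * qBar q θ ω * dscSecond u q hθ θ ω|
      ≤ C * max hθ hω ^ 4 := by
  intro K hK
  obtain ⟨R, hR⟩ := hK.isBounded.exists_norm_le
  obtain ⟨C, hC0, hC⟩ := (isBigO_compactC_sub (R := R) hu hq hqpos).exists_pos
  refine ⟨C, hC0, fun θ ω hp hθ hhθ hω hhω => ?_⟩
  have hle := hR _ hp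
  have h := isBigOWith_principal.1 hC (θ, ω, hθ, hω)
    ⟨(norm_fst_le (θ, ω)).trans hle, (norm_snd_le (θ, ω)).trans hle, hhθ, hhω⟩
  have hmax : 0 ≤ max hθ hω := hhθ.1.le.trans (le_max_left _ _)
  simpa only [Real.norm_eq_abs, maxStep, abs_of_nonneg (pow_nonneg hmax 4)] using h
end
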